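/- arXiv:0810.2214 — 5 statements merged into one kernel-verified Lean document; each statement's English description precedes it below -/
import Mathlib

section
/- For every odd integer k with k ≥ 3 and every integer m with m ≥ k, there exists a k-homogeneous Latin bitrade of volume k·m. -/
/-- A partial Latin square: a finite set of (row, column, entry) triples such that
no two distinct triples agree in (row, column), in (row, entry), or in (column, entry). -/
def IsPartialLatinSquare (T : Finset (ℕ × ℕ × ℕ)) : Prop :=
  (∀ x ∈ T, ∀ y ∈ T, x.1 = y.1 → x.2.1 = y.2.1 → x = y) ∧
  (∀ x ∈ T, ∀ y ∈ T, x.1 = y.1 → x.2.2 = y.2.2 → x = y) ∧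
  (∀ x ∈ T, ∀ y ∈ T, x.2.1 = y.2.1 → x.2.2 = y.2.2 → x = y)

/-- A Latin bitrade: a pair of disjoint partial Latin squares with the same filled
cells, the same entry set in each row, and the same entry set in each column. -/
def IsLatinBitrade (T T' : Finset (ℕ × ℕ × ℕ)) : Prop :=
  IsPartialLatinSquare T ∧ IsPartialLatinSquare T' ∧
  Disjoint T T' ∧
  (∀ r c, (∃ e, (r, c, e) ∈ T) ↔ (∃ e, (r, c, e) ∈ T')) ∧
  (∀ r e, (∃ c, (r, c, e) ∈ T) ↔ (∃ c, (r, c, e) ∈ T')) ∧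
  (∀ c e, (∃ r, (r, c, e) ∈ T) ↔ (∃ r, (r, c, e) ∈ T'))

/-- A Latin bitrade is k-homogeneous if each nonempty row and column of T contains
exactly k filled cells, and each entry value occurring in T occurs exactly k times. -/
def IsHomogeneousLatinBitrade (k : ℕ) (T T' : Finset (ℕ × ℕ × ℕ)) : Prop :=
  IsLatinBitrade T T' ∧
  (∀ r, (∃ x ∈ T, x.1 = r) → (T.filter (fun x => x.1 = r)).card = k) ∧
  (∀ c, (∃ x ∈ T, x.2.1 = c) → (T.filter (fun x => x.2.1 = c)).card = k) ∧
  (∀ e, (∃ x ∈ T, x.2.2 = e) → (T.filter (fun x => x.2.2 = e)).card = k)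

/-- A Latin bitrade (T, T') is primary if every nonempty Latin bitrade (U, U') with
U ⊆ T and U' ⊆ T' satisfies U = T and U' = T'. -/
def IsPrimaryLatinBitrade (T T' : Finset (ℕ × ℕ × ℕ)) : Prop :=
  IsLatinBitrade T T' ∧
  ∀ U U' : Finset (ℕ × ℕ × ℕ), IsLatinBitrade U U' → U.Nonempty →
    U ⊆ T → U' ⊆ T' → U = T ∧ U' = T'

/-- Cyclic partial Latin square generated from a base row. -/
def cycT {G ι : Type} [AddCommGroup G] [Fintype G] [Fintype ι] (φ : G → ℕ) (a b : ι → G) :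
    Finset (ℕ × ℕ × ℕ) :=
  (Finset.univ : Finset (G × ι)).image (fun p => (φ p.1, φ (p.1 + a p.2), φ (p.1 + b p.2)))

theorem mem_cycT {G ι : Type} [AddCommGroup G] [Fintype G] [Fintype ι] (φ : G → ℕ) (a b : ι → G)
    (r c e : ℕ) : (r, c, e) ∈ cycT φ a b ↔ ∃ g i, φ g = r ∧ φ (g + a i) = c ∧ φ (g + b i) = e := by
  simp [cycT]

theorem cycT_pls {G ι : Type} [AddCommGroup G] [Fintype G] [Fintype ι] (φ : G → ℕ)
    (hφ : Function.Injective φ) (a b : ι → G) (ha : Function.Injective a)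
    (hb : Function.Injective b) (hd : Function.Injective (fun i => b i - a i)) :
    IsPartialLatinSquare (cycT φ a b) := by
  refine ⟨?_, ?_, ?_⟩ <;> rintro ⟨r, c, e⟩ hx ⟨r', c', e'⟩ hy <;> rw [mem_cycT] at hx hy <;>
    obtain ⟨g, i, rfl, rfl, rfl⟩ := hx <;> obtain ⟨g', i', rfl, rfl, rfl⟩ := hy <;>
    intro h1 h2 <;> replace h1 := hφ h1 <;> replace h2 := hφ h2
  · subst h1
    have := ha (add_left_cancel h2)
    subst this; rfl
  · subst h1
    have := hb (add_left_cancel h2)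
    subst this; rfl
  · have : i = i' := hd (by
      have : (g + b i) - (g + a i) = (g' + b i') - (g' + a i') := by rw [h1, h2]
      simpa using this)
    subst this
    have := add_right_cancel h1
    subst this; rfl

theorem cycT_sub {G ι : Type} [AddCommGroup G] [Fintype G] [Fintype ι] (φ : G → ℕ)
    (a b b' : ι → G)
    (hb : ∀ i, ∃ j, b i = b' j) (hd : ∀ i, ∃ j, b i - a i = b' j - a j) :
    (∀ r c, (∃ e, (r, c, e) ∈ cycT φ a b) → (∃ e, (r, c, e) ∈ cycT φ a b')) ∧
    (∀ r e, (∃ c, (r, c, e) ∈ cycT φ a b) → (∃ c, (r, c, e) ∈ cycT φ a b')) ∧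
    (∀ c e, (∃ r, (r, c, e) ∈ cycT φ a b) → (∃ r, (r, c, e) ∈ cycT φ a b')) := by
  simp only [mem_cycT]
  refine ⟨?_, ?_, ?_⟩
  · rintro r c ⟨e, g, i, rfl, rfl, rfl⟩
    exact ⟨_, g, i, rfl, rfl, rfl⟩
  · rintro r c ⟨e, g, i, rfl, rfl, rfl⟩
    obtain ⟨j, hj⟩ := hb i
    exact ⟨_, g, j, rfl, rfl, by rw [hj]⟩
  · rintro r c ⟨e, g, i, rfl, rfl, rfl⟩
    obtain ⟨j, hj⟩ := hd i
    refine ⟨_, g + a i - a j, j, rfl, by simp, ?_⟩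
    congr 1
    have : b i = b' j - a j + a i := by rw [← hj]; abel
    rw [this]; abel

theorem cycT_hom {G ι : Type} [AddCommGroup G] [Fintype G] [Fintype ι] (φ : G → ℕ)
    (hφ : Function.Injective φ) (a b b' : ι → G) (ha : Function.Injective a)
    (hb : Function.Injective b) (hd : Function.Injective (fun i => b i - a i))
    (hb' : Function.Injective b') (hd' : Function.Injective (fun i => b' i - a i))
    (hne : ∀ i, b i ≠ b' i)
    (h1 : ∀ i, ∃ j, b i = b' j) (h2 : ∀ i, ∃ j, b i - a i = b' j - a j)
    (h3 : ∀ i, ∃ j, b' i = b j) (h4 : ∀ i, ∃ j, b' i - a i = b j - a j) :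
    IsHomogeneousLatinBitrade (Fintype.card ι) (cycT φ a b) (cycT φ a b') ∧
      (cycT φ a b).card = Fintype.card ι * Fintype.card G := by
  obtain ⟨s1, s2, s3⟩ := cycT_sub φ a b b' h1 h2
  obtain ⟨t1, t2, t3⟩ := cycT_sub φ a b' b h3 h4
  refine ⟨⟨⟨cycT_pls φ hφ a b ha hb hd, cycT_pls φ hφ a b' ha hb' hd', ?_,
    fun r c => ⟨s1 r c, t1 r c⟩, fun r c => ⟨s2 r c, t2 r c⟩, fun r c => ⟨s3 r c, t3 r c⟩⟩,
    ?_, ?_, ?_⟩, ?_⟩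
  · rw [Finset.disjoint_left]
    rintro ⟨r, c, e⟩ hx hy
    rw [mem_cycT] at hx hy
    obtain ⟨g, i, rfl, rfl, rfl⟩ := hx
    obtain ⟨g', i', q1, q2, q3⟩ := hy
    have := hφ q1
    subst this
    have := ha (add_left_cancel (hφ q2))
    subst this
    exact hne _ (add_left_cancel (hφ q3)).symm
  · rintro r ⟨⟨r', c, e⟩, hx, rfl⟩
    rw [mem_cycT] at hx
    obtain ⟨g, i, rfl, rfl, rfl⟩ := hx
    have : (cycT φ a b).filter (fun x => x.1 = φ g) =
        Finset.univ.image (fun i : ι => (φ g, φ (g + a i), φ (g + b i))) := by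
      ext ⟨r, c, e⟩
      simp only [Finset.mem_filter, mem_cycT, Finset.mem_image, Finset.mem_univ, true_and,
        Prod.mk.injEq]
      constructor
      · rintro ⟨⟨g', j, rfl, rfl, rfl⟩, h⟩
        have := hφ h
        subst this
        exact ⟨j, rfl, rfl, rfl⟩
      · rintro ⟨j, rfl, rfl, rfl⟩
        exact ⟨⟨g, j, rfl, rfl, rfl⟩, rfl⟩
    simp only [this]
    rw [Finset.card_image_of_injective, Finset.card_univ]
    intro i j hij
    simp only [Prod.mk.injEq] at hij
    exact ha (add_left_cancel (hφ hij.2.1))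
  · rintro r ⟨⟨r', c, e⟩, hx, rfl⟩
    rw [mem_cycT] at hx
    obtain ⟨g, i, rfl, rfl, rfl⟩ := hx
    have : (cycT φ a b).filter (fun x => x.2.1 = φ (g + a i)) =
        Finset.univ.image (fun j : ι => (φ (g + a i - a j), φ (g + a i), φ (g + a i - a j + b j))) := by
      ext ⟨r, c, e⟩
      simp only [Finset.mem_filter, mem_cycT, Finset.mem_image, Finset.mem_univ, true_and,
        Prod.mk.injEq]
      constructor
      · rintro ⟨⟨g', j, rfl, rfl, rfl⟩, h⟩
        have := hφ h
        exact ⟨j, by rw [← this]; simp, by rw [← this], by rw [← this]; simp⟩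
      · rintro ⟨j, rfl, rfl, rfl⟩
        exact ⟨⟨_, j, rfl, by simp, rfl⟩, rfl⟩
    simp only [this]
    rw [Finset.card_image_of_injective, Finset.card_univ]
    intro i j hij
    simp only [Prod.mk.injEq] at hij
    exact ha (sub_right_injective (hφ hij.1))
  · rintro r ⟨⟨r', c, e⟩, hx, rfl⟩
    rw [mem_cycT] at hx
    obtain ⟨g, i, rfl, rfl, rfl⟩ := hx
    have : (cycT φ a b).filter (fun x => x.2.2 = φ (g + b i)) =
        Finset.univ.image (fun j : ι => (φ (g + b i - b j), φ (g + b i - b j + a j), φ (g + b i))) := by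
      ext ⟨r, c, e⟩
      simp only [Finset.mem_filter, mem_cycT, Finset.mem_image, Finset.mem_univ, true_and,
        Prod.mk.injEq]
      constructor
      · rintro ⟨⟨g', j, rfl, rfl, rfl⟩, h⟩
        have := hφ h
        exact ⟨j, by rw [← this]; simp, by rw [← this]; simp, by rw [← this]⟩
      · rintro ⟨j, rfl, rfl, rfl⟩
        exact ⟨⟨_, j, rfl, rfl, by simp⟩, rfl⟩
    simp only [this]
    rw [Finset.card_image_of_injective, Finset.card_univ]
    intro i j hij
    simp only [Prod.mk.injEq] at hij
    exact hb (sub_right_injective (hφ hij.1))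
  · rw [cycT, Finset.card_image_of_injective, Finset.card_univ, Fintype.card_prod, mul_comm]
    rintro ⟨g, i⟩ ⟨g', i'⟩ h
    simp only [Prod.mk.injEq] at h
    have := hφ h.1
    subst this
    have := ha (add_left_cancel (hφ h.2.1))
    subst this; rfl

theorem cast_inj_small {m x y : ℕ} (hx : x < m) (hy : y < m) (h : (x : ZMod m) = y) : x = y := by
  rw [ZMod.natCast_eq_natCast_iff] at h
  exact Nat.ModEq.eq_of_lt_of_lt h hx hy

theorem stmt_0 (k m : ℕ) (hk : Odd k) (hk3 : 3 ≤ k) (hm : k ≤ m) :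
    ∃ T T' : Finset (ℕ × ℕ × ℕ),
      IsHomogeneousLatinBitrade k T T' ∧ T.card = k * m := by
  obtain ⟨h, rfl⟩ := hk
  haveI : NeZero m := ⟨by omega⟩
  let f : ℕ → ℕ := fun i => if i ≤ h then h - i else 3 * h + 1 - i
  let f' : ℕ → ℕ := fun i => if i < h then h - 1 - i else 3 * h - i
  let D : ℕ → ℕ := fun i => if i ≤ h then 2 * h - 2 * i else 4 * h + 1 - 2 * i
  let D' : ℕ → ℕ := fun i => if i < h then 2 * h - 1 - 2 * i else 4 * h - 2 * i
  have eD : ∀ i : Fin (2 * h + 1), ((f i : ℕ) : ZMod m) - ((i : ℕ) : ZMod m) = (D i : ℕ) - (h : ℕ) := by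
    intro i
    have hi := i.2
    have : f i + h = D i + i := by simp only [f, D]; split_ifs <;> omega
    have : ((f i + h : ℕ) : ZMod m) = ((D i + i : ℕ) : ZMod m) := by rw [this]
    push_cast at this
    linear_combination this
  have eD' : ∀ i : Fin (2 * h + 1), ((f' i : ℕ) : ZMod m) - ((i : ℕ) : ZMod m) = (D' i : ℕ) - (h : ℕ) := by
    intro i
    have hi := i.2
    have : f' i + h = D' i + i := by simp only [f', D']; split_ifs <;> omega
    have : ((f' i + h : ℕ) : ZMod m) = ((D' i + i : ℕ) : ZMod m) := by rw [this]
    push_cast at this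
    linear_combination this
  have key : ∀ F : ℕ → ℕ, (∀ i, i < 2 * h + 1 → F i < 2 * h + 1) →
      (∀ i j, i < 2 * h + 1 → j < 2 * h + 1 → F i = F j → i = j) →
      Function.Injective (fun i : Fin (2 * h + 1) => ((F i : ℕ) : ZMod m)) := by
    intro F hF hinj i j hij
    have a1 := hF i i.2
    have a2 := hF j j.2
    exact Fin.ext (hinj i j i.2 j.2 (cast_inj_small (by omega) (by omega) hij))
  have H := cycT_hom (G := ZMod m) (ι := Fin (2 * h + 1)) ZMod.val (ZMod.val_injective m)
    (fun i => ((i : ℕ) : ZMod m)) (fun i => ((f i : ℕ) : ZMod m)) (fun i => ((f' i : ℕ) : ZMod m))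
    (key (fun i => i) (fun i hi => hi) (fun i j _ _ e => e))
    (key f (fun i hi => by simp only [f]; split_ifs <;> omega)
      (fun i j hi hj => by simp only [f]; split_ifs <;> omega))
    (by
      simp only [eD]
      exact (sub_left_injective (b := (h : ZMod m))).comp
        (key D (fun i hi => by simp only [D]; split_ifs <;> omega)
          (fun i j hi hj => by simp only [D]; split_ifs <;> omega)))
    (key f' (fun i hi => by simp only [f']; split_ifs <;> omega)
      (fun i j hi hj => by simp only [f']; split_ifs <;> omega))
    (by
      simp only [eD']
      exact (sub_left_injective (b := (h : ZMod m))).comp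
        (key D' (fun i hi => by simp only [D']; split_ifs <;> omega)
          (fun i j hi hj => by simp only [D']; split_ifs <;> omega)))
    (by
      intro i e
      have hi := i.2
      have := cast_inj_small (by simp only [f]; split_ifs <;> omega)
        (by simp only [f']; split_ifs <;> omega) e
      simp only [f, f'] at this
      split_ifs at this <;> omega)
    (by
      intro i
      have hi := i.2
      refine ⟨⟨if 1 ≤ (i : ℕ) then i - 1 else 2 * h, by split_ifs <;> omega⟩, ?_⟩
      congr 1
      simp only [f, f']
      split_ifs <;> omega)
    (by
      intro i
      have hi := i.2
      refine ⟨⟨if (i : ℕ) ≤ h then h + i else i - h - 1, by split_ifs <;> omega⟩, ?_⟩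
      rw [eD, eD']
      congr 2
      simp only [D, D']
      split_ifs <;> omega)
    (by
      intro i
      have hi := i.2
      refine ⟨⟨if (i : ℕ) < 2 * h then i + 1 else 0, by split_ifs <;> omega⟩, ?_⟩
      congr 1
      simp only [f, f']
      split_ifs <;> omega)
    (by
      intro i
      have hi := i.2
      refine ⟨⟨if (i : ℕ) < h then i + h + 1 else i - h, by split_ifs <;> omega⟩, ?_⟩
      rw [eD, eD']
      congr 2
      simp only [D, D']
      split_ifs <;> omega)
  simp only [Fintype.card_fin, ZMod.card] at H
  exact ⟨_, _, H⟩
end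

section
/- For every odd integer k with k ≥ 3 and every integer m with m ≥ k, there exists a primary k-homogeneous Latin bitrade of volume k·m. -/
/-- Reduction modulo `n` of a number below `2 * n`. -/
def wr (n x : ℕ) : ℕ := if x < n then x else x - n

/-- The `j`-th triple in row `i`, with shift `s`. -/
def tr (k m s i j : ℕ) : ℕ × ℕ × ℕ := (i, wr m (i + j), wr m (i + wr k (2 * j + s)))

/-- The trade (`s = 0`) and its mate (`s = 1`). -/
def TT (k m s : ℕ) : Finset (ℕ × ℕ × ℕ) :=
  (Finset.range m ×ˢ Finset.range k).image (fun p => tr k m s p.1 p.2)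

theorem mem_TT' (k m s : ℕ) (x : ℕ × ℕ × ℕ) :
    x ∈ TT k m s ↔ ∃ i j, i < m ∧ j < k ∧ tr k m s i j = x := by
  simp [TT, and_assoc]

theorem mem_TT {l m s r c e : ℕ} (hm : 2 * l + 1 ≤ m) (hs : s ≤ 1) :
    (r, c, e) ∈ TT (2 * l + 1) m s ↔ ∃ j a, j < 2 * l + 1 ∧ r < m ∧ a < 2 * l + 1 ∧ c < m ∧ e < m ∧
      (c = r + j ∨ c + m = r + j) ∧ (a = 2 * j + s ∨ a + (2 * l + 1) = 2 * j + s) ∧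
      (e = r + a ∨ e + m = r + a) := by
  rw [mem_TT']
  constructor
  · rintro ⟨i, j, hi, hj, h⟩
    simp only [tr, wr, Prod.mk.injEq] at h
    refine ⟨j, if 2 * j + s < 2 * l + 1 then 2 * j + s else 2 * j + s - (2 * l + 1), ?_⟩
    split_ifs at * <;> omega
  · rintro ⟨j, a, h⟩
    refine ⟨r, j, by omega, by omega, ?_⟩
    have ha : wr (2 * l + 1) (2 * j + s) = a := by
      simp only [wr]; split_ifs <;> omega
    simp only [tr, ha, Prod.mk.injEq]
    simp only [wr, true_and]
    constructor <;> split_ifs <;> omega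

theorem pls {l m s : ℕ} (hm : 2 * l + 1 ≤ m) (hs : s ≤ 1) :
    IsPartialLatinSquare (TT (2 * l + 1) m s) := by
  refine ⟨?_, ?_, ?_⟩ <;>
  · rintro ⟨r, c, e⟩ hx ⟨r', c', e'⟩ hy h1 h2
    rw [mem_TT hm hs] at hx hy
    obtain ⟨j, a, hx⟩ := hx
    obtain ⟨j', a', hy⟩ := hy
    simp only [Prod.mk.injEq] at *
    have : j = j' := by omega
    omega

theorem bitrade {l m : ℕ} (hl : 1 ≤ l) (hm : 2 * l + 1 ≤ m) :
    IsLatinBitrade (TT (2 * l + 1) m 0) (TT (2 * l + 1) m 1) := by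
  refine ⟨pls hm (by omega), pls hm (by omega), ?_, ?_, ?_, ?_⟩
  · rw [Finset.disjoint_left]
    rintro ⟨r, c, e⟩ hx hy
    rw [mem_TT hm (by omega)] at hx hy
    obtain ⟨j, a, hx⟩ := hx
    obtain ⟨j', a', hy⟩ := hy
    have : j = j' := by omega
    omega
  · intro r c
    simp only [mem_TT' , tr, Prod.mk.injEq]
    constructor <;> rintro ⟨e, i, j, hi, hj, h1, h2, h3⟩ <;> exact ⟨_, i, j, hi, hj, h1, h2, rfl⟩
  · intro r e
    simp only [mem_TT hm (show 0 ≤ 1 by omega), mem_TT hm (show 1 ≤ 1 by omega)]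
    constructor
    · rintro ⟨c, j, a, h⟩
      refine ⟨wr m (r + wr (2 * l + 1) (j + l)), wr (2 * l + 1) (j + l), a, ?_⟩
      simp only [wr]
      split_ifs <;> omega
    · rintro ⟨c, j, a, h⟩
      refine ⟨wr m (r + wr (2 * l + 1) (j + l + 1)), wr (2 * l + 1) (j + l + 1), a, ?_⟩
      simp only [wr]
      split_ifs <;> omega
  · intro c e
    simp only [mem_TT hm (show 0 ≤ 1 by omega), mem_TT hm (show 1 ≤ 1 by omega)]
    constructor
    · rintro ⟨r, j, a, h⟩
      refine ⟨wr m (c + (m - wr (2 * l + 1) (j + 2 * l))), wr (2 * l + 1) (j + 2 * l),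
        wr (2 * l + 1) (2 * wr (2 * l + 1) (j + 2 * l) + 1), ?_⟩
      simp only [wr]
      split_ifs <;> omega
    · rintro ⟨r, j, a, h⟩
      refine ⟨wr m (c + (m - wr (2 * l + 1) (j + 1))), wr (2 * l + 1) (j + 1),
        wr (2 * l + 1) (2 * wr (2 * l + 1) (j + 1)), ?_⟩
      simp only [wr]
      split_ifs <;> omega

theorem tr_inj {l m s i j i' j' : ℕ} (hm : 2 * l + 1 ≤ m) (hi : i < m) (hj : j < 2 * l + 1)
    (hj' : j' < 2 * l + 1)
    (h : tr (2 * l + 1) m s i j = tr (2 * l + 1) m s i' j') : i = i' ∧ j = j' := by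
  simp only [tr, Prod.mk.injEq, wr] at h
  obtain ⟨h1, h2, -⟩ := h
  split_ifs at h2 <;> omega

theorem card_aux {l m s : ℕ} (hm : 2 * l + 1 ≤ m) (P : ℕ × ℕ × ℕ → Prop) [DecidablePred P]
    (f : ℕ → ℕ) (hf : ∀ j < 2 * l + 1, f j < m)
    (h : ∀ i < m, ∀ j < 2 * l + 1, P (tr (2 * l + 1) m s i j) ↔ i = f j) :
    ((TT (2 * l + 1) m s).filter P).card = 2 * l + 1 := by
  have : (TT (2 * l + 1) m s).filter P =
      (Finset.range (2 * l + 1)).image (fun j => tr (2 * l + 1) m s (f j) j) := by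
    ext x
    simp only [Finset.mem_filter, mem_TT', Finset.mem_image, Finset.mem_range]
    constructor
    · rintro ⟨⟨i, j, hi, hj, rfl⟩, hP⟩
      rw [h i hi j hj] at hP
      exact ⟨j, hj, by rw [hP]⟩
    · rintro ⟨j, hj, rfl⟩
      exact ⟨⟨f j, j, hf j hj, hj, rfl⟩, (h _ (hf j hj) j hj).2 rfl⟩
  rw [this, Finset.card_image_of_injOn, Finset.card_range]
  intro j hj j' hj' hh
  simp only [Finset.coe_range, Set.mem_Iio] at hj hj'
  exact (tr_inj hm (hf j hj) hj hj' hh).2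

theorem homog {l m : ℕ} (hl : 1 ≤ l) (hm : 2 * l + 1 ≤ m) :
    IsHomogeneousLatinBitrade (2 * l + 1) (TT (2 * l + 1) m 0) (TT (2 * l + 1) m 1) := by
  refine ⟨bitrade hl hm, ?_, ?_, ?_⟩
  · rintro r ⟨⟨r', c, e⟩, hx, rfl⟩
    rw [mem_TT hm (by omega)] at hx
    obtain ⟨_, _, hx⟩ := hx
    refine card_aux hm _ (fun _ => r') (fun _ _ => by omega) ?_
    intro i hi j hj
    simp [tr]
  · rintro c ⟨⟨r, c', e⟩, hx, rfl⟩
    rw [mem_TT hm (by omega)] at hx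
    obtain ⟨_, _, hx⟩ := hx
    refine card_aux hm _ (fun j => wr m (c' + (m - j))) (fun j hj => ?_) ?_
    · simp only [wr]; split_ifs <;> omega
    · intro i hi j hj
      simp only [tr, wr]; split_ifs <;> omega
  · rintro e ⟨⟨r, c, e'⟩, hx, rfl⟩
    rw [mem_TT hm (by omega)] at hx
    obtain ⟨_, _, hx⟩ := hx
    refine card_aux hm _ (fun j => wr m (e' + (m - wr (2 * l + 1) (2 * j)))) (fun j hj => ?_) ?_
    · simp only [wr]; split_ifs <;> omega
    · intro i hi j hj
      simp only [tr, wr]; split_ifs <;> omega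

theorem card_TT {l m : ℕ} (hm : 2 * l + 1 ≤ m) :
    (TT (2 * l + 1) m 0).card = (2 * l + 1) * m := by
  rw [TT, Finset.card_image_of_injOn, Finset.card_product, Finset.card_range, Finset.card_range,
    mul_comm]
  rintro ⟨i, j⟩ h ⟨i', j'⟩ h' hh
  simp only [Finset.coe_product, Finset.coe_range, Set.mem_prod, Set.mem_Iio] at h h'
  have := tr_inj hm h.1 h.2 h'.2 hh
  simp [this.1, this.2]

set_option maxHeartbeats 4000000 in
theorem primary {l m : ℕ} (hl : 1 ≤ l) (hm : 2 * l + 1 ≤ m) :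
    IsPrimaryLatinBitrade (TT (2 * l + 1) m 0) (TT (2 * l + 1) m 1) := by
  refine ⟨bitrade hl hm, ?_⟩
  rintro U U' ⟨-, -, -, hrc, hre, hce⟩ ⟨x, hx⟩ hU hU'
  have cell : ∀ i < m, ∀ j < 2 * l + 1,
      tr (2 * l + 1) m 0 i j ∈ U ↔ tr (2 * l + 1) m 1 i j ∈ U' := by
    intro i hi j hj
    constructor
    · intro h
      obtain ⟨e, he⟩ := (hrc _ _).1 ⟨_, h⟩
      obtain ⟨i', j', hi', hj', h'⟩ := (mem_TT' _ _ _ _).1 (hU' he)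
      have h2 := h'
      simp only [tr, Prod.mk.injEq, wr] at h'
      obtain ⟨h1, h3, -⟩ := h'
      have : i' = i ∧ j' = j := by split_ifs at h3 <;> omega
      rw [this.1, this.2] at h2
      rw [h2]; exact he
    · intro h
      obtain ⟨e, he⟩ := (hrc _ _).2 ⟨_, h⟩
      obtain ⟨i', j', hi', hj', h'⟩ := (mem_TT' _ _ _ _).1 (hU he)
      have h2 := h'
      simp only [tr, Prod.mk.injEq, wr] at h'
      obtain ⟨h1, h3, -⟩ := h'
      have : i' = i ∧ j' = j := by split_ifs at h3 <;> omega
      rw [this.1, this.2] at h2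
      rw [h2]; exact he
  have row : ∀ i < m, ∀ j < 2 * l + 1, tr (2 * l + 1) m 0 i j ∈ U →
      tr (2 * l + 1) m 0 i (wr (2 * l + 1) (j + l)) ∈ U := by
    intro i hi j hj h
    obtain ⟨c, hc⟩ := (hre _ _).1 ⟨_, h⟩
    obtain ⟨i', j', hi', hj', h'⟩ := (mem_TT' _ _ _ _).1 (hU' hc)
    rw [← h', ← cell i' hi' j' hj'] at hc
    simp only [tr, Prod.mk.injEq] at h'
    obtain ⟨h1, -, h3⟩ := h'
    have : i' = i ∧ j' = wr (2 * l + 1) (j + l) := by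
      simp only [wr] at h3 ⊢
      split_ifs at h3 ⊢ <;> omega
    rw [← this.1, ← this.2]; exact hc
  have col : ∀ i < m, ∀ j < 2 * l + 1, 1 ≤ j → tr (2 * l + 1) m 0 i j ∈ U →
      tr (2 * l + 1) m 0 (wr m (i + 1)) (j - 1) ∈ U := by
    intro i hi j hj hj1 h
    obtain ⟨c, hc⟩ := (hce _ _).1 ⟨_, h⟩
    have h0 := (mem_TT hm (by omega)).1 (hU h)
    have h0' := (mem_TT hm (by omega)).1 (hU' hc)
    obtain ⟨i', j', hi', hj', h'⟩ := (mem_TT' _ _ _ _).1 (hU' hc)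
    rw [← h', ← cell i' hi' j' hj'] at hc
    simp only [tr, Prod.mk.injEq] at h'
    obtain ⟨-, h1, h3⟩ := h'
    have : i' = wr m (i + 1) ∧ j' = j - 1 := by
      simp only [wr] at h1 h3 ⊢
      split_ifs at h1 h3 ⊢ <;> omega
    rw [← this.1, ← this.2]; exact hc
  have dec : ∀ i < m, ∀ j < 2 * l + 1, tr (2 * l + 1) m 0 i j ∈ U →
      tr (2 * l + 1) m 0 i (if j = 0 then 2 * l else j - 1) ∈ U := by
    intro i hi j hj h
    have h1 := row i hi _ (by simp only [wr]; split_ifs <;> omega) (row i hi j hj h)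
    have : wr (2 * l + 1) (wr (2 * l + 1) (j + l) + l) = if j = 0 then 2 * l else j - 1 := by
      simp only [wr]; split_ifs <;> omega
    rwa [this] at h1
  have down : ∀ i < m, ∀ d j, j + d < 2 * l + 1 → tr (2 * l + 1) m 0 i (j + d) ∈ U →
      tr (2 * l + 1) m 0 i j ∈ U := by
    intro i hi d
    induction d with
    | zero => intro j _ h; exact h
    | succ d ih =>
      intro j hj h
      have := dec i hi _ hj h
      rw [if_neg (by omega)] at this
      exact ih j (by omega) this
  have full : ∀ i < m, ∀ j < 2 * l + 1, tr (2 * l + 1) m 0 i j ∈ U →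
      ∀ j' < 2 * l + 1, tr (2 * l + 1) m 0 i j' ∈ U := by
    intro i hi j hj h j' hj'
    have h0 := down i hi j 0 (by omega) (by simpa using h)
    have h1 := dec i hi 0 (by omega) h0
    rw [if_pos rfl] at h1
    exact down i hi (2 * l - j') j' (by omega) (by rwa [show j' + (2 * l - j') = 2 * l by omega])
  have next : ∀ i < m, tr (2 * l + 1) m 0 i 0 ∈ U → tr (2 * l + 1) m 0 (wr m (i + 1)) 0 ∈ U := by
    intro i hi h
    exact col i hi 1 (by omega) le_rfl (full i hi 0 (by omega) h 1 (by omega))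
  have up : ∀ d i, i + d < m → tr (2 * l + 1) m 0 i 0 ∈ U → tr (2 * l + 1) m 0 (i + d) 0 ∈ U := by
    intro d
    induction d with
    | zero => intro i _ h; exact h
    | succ d ih =>
      intro i hi h
      have := next _ (by omega) (ih i (by omega) h)
      rw [wr, if_pos (by omega)] at this
      exact this
  have all : ∀ i < m, ∀ j < 2 * l + 1, tr (2 * l + 1) m 0 i j ∈ U := by
    intro i hi j hj
    obtain ⟨i₀, j₀, hi₀, hj₀, rfl⟩ := (mem_TT' _ _ _ _).1 (hU hx)
    have h0 := full i₀ hi₀ j₀ hj₀ hx 0 (by omega)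
    have h1 := up (m - 1 - i₀) i₀ (by omega) h0
    have h2 := next _ (by omega) h1
    rw [wr, if_neg (by omega), show i₀ + (m - 1 - i₀) + 1 - m = 0 by omega] at h2
    have h3 := up i 0 (by omega) h2
    rw [zero_add] at h3
    exact full i hi 0 (by omega) h3 j hj
  constructor
  · refine Finset.Subset.antisymm hU ?_
    intro y hy
    obtain ⟨i, j, hi, hj, rfl⟩ := (mem_TT' _ _ _ _).1 hy
    exact all i hi j hj
  · refine Finset.Subset.antisymm hU' ?_
    intro y hy
    obtain ⟨i, j, hi, hj, rfl⟩ := (mem_TT' _ _ _ _).1 hy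
    exact (cell i hi j hj).1 (all i hi j hj)

theorem stmt_1 (k m : ℕ) (hk : Odd k) (hk3 : 3 ≤ k) (hm : k ≤ m) :
    ∃ T T' : Finset (ℕ × ℕ × ℕ),
      IsHomogeneousLatinBitrade k T T' ∧ IsPrimaryLatinBitrade T T' ∧
      T.card = k * m := by
  obtain ⟨l, rfl⟩ := hk
  exact ⟨_, _, homog (by omega) hm, primary (by omega) hm, card_TT hm⟩
end

section
/- Let k, ℓ, m, n be positive integers with m ≥ k and n ≥ ℓ. If there exists a k-homogeneous Latin bitrade of volume k·m and there exists an ℓ-homogeneous Latin bitrade of volume ℓ·n, then there exists a (k·ℓ)-homogeneous Latin bitrade of volume (k·ℓ)·(m·n). -/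
/-- Product of two sets of triples, coordinates combined by the pairing function. -/
def tripleProd (T S : Finset (ℕ × ℕ × ℕ)) : Finset (ℕ × ℕ × ℕ) :=
  (T ×ˢ S).image (fun p =>
    (Nat.pair p.1.1 p.2.1, Nat.pair p.1.2.1 p.2.2.1, Nat.pair p.1.2.2 p.2.2.2))

theorem mem_tripleProd (T S : Finset (ℕ × ℕ × ℕ)) (r c e : ℕ) :
    (r, c, e) ∈ tripleProd T S ↔
      (r.unpair.1, c.unpair.1, e.unpair.1) ∈ T ∧ (r.unpair.2, c.unpair.2, e.unpair.2) ∈ S := by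
  unfold tripleProd
  simp only [Finset.mem_image, Finset.mem_product]
  constructor
  · rintro ⟨⟨⟨a, b, d⟩, ⟨a', b', d'⟩⟩, ⟨h1, h2⟩, h⟩
    simp only [Prod.mk.injEq] at h
    obtain ⟨rfl, rfl, rfl⟩ := h
    simp only [Nat.unpair_pair]
    exact ⟨h1, h2⟩
  · rintro ⟨h1, h2⟩
    exact ⟨(_, _), ⟨h1, h2⟩, by simp [Nat.pair_unpair]⟩

theorem card_tripleProd (T S : Finset (ℕ × ℕ × ℕ)) :
    (tripleProd T S).card = T.card * S.card := by
  unfold tripleProd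
  rw [Finset.card_image_of_injective, Finset.card_product]
  rintro ⟨⟨a, b, d⟩, ⟨a', b', d'⟩⟩ ⟨⟨u, v, w⟩, ⟨u', v', w'⟩⟩ h
  simp only [Prod.mk.injEq, Nat.pair_eq_pair] at h
  simp only [Prod.mk.injEq]
  tauto

theorem unpair_ext {a b : ℕ} (h1 : a.unpair.1 = b.unpair.1) (h2 : a.unpair.2 = b.unpair.2) :
    a = b := by
  rw [← Nat.pair_unpair a, ← Nat.pair_unpair b, h1, h2]

theorem unpair_eq_iff {a b : ℕ} :
    a = b ↔ a.unpair.1 = b.unpair.1 ∧ a.unpair.2 = b.unpair.2 :=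
  ⟨fun h => by simp [h], fun h => unpair_ext h.1 h.2⟩

theorem pls_tripleProd {T S : Finset (ℕ × ℕ × ℕ)} (hT : IsPartialLatinSquare T)
    (hS : IsPartialLatinSquare S) : IsPartialLatinSquare (tripleProd T S) := by
  obtain ⟨t1, t2, t3⟩ := hT
  obtain ⟨s1, s2, s3⟩ := hS
  refine ⟨?_, ?_, ?_⟩
  · rintro ⟨r, c, e⟩ hx ⟨r', c', e'⟩ hy h h'
    rw [mem_tripleProd] at hx hy
    dsimp only at h h'
    subst h h'
    have a := t1 _ hx.1 _ hy.1 rfl rfl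
    have b := s1 _ hx.2 _ hy.2 rfl rfl
    simp only [Prod.mk.injEq, true_and] at a b ⊢
    exact unpair_ext a b
  · rintro ⟨r, c, e⟩ hx ⟨r', c', e'⟩ hy h h'
    rw [mem_tripleProd] at hx hy
    dsimp only at h h'
    subst h h'
    have a := t2 _ hx.1 _ hy.1 rfl rfl
    have b := s2 _ hx.2 _ hy.2 rfl rfl
    simp only [Prod.mk.injEq, true_and, and_true] at a b ⊢
    exact unpair_ext a b
  · rintro ⟨r, c, e⟩ hx ⟨r', c', e'⟩ hy h h'
    rw [mem_tripleProd] at hx hy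
    dsimp only at h h'
    subst h h'
    have a := t3 _ hx.1 _ hy.1 rfl rfl
    have b := s3 _ hx.2 _ hy.2 rfl rfl
    simp only [Prod.mk.injEq, and_true] at a b ⊢
    exact unpair_ext a b

theorem exists_unpair (p q : ℕ → Prop) :
    (∃ e : ℕ, p e.unpair.1 ∧ q e.unpair.2) ↔ (∃ a, p a) ∧ (∃ b, q b) := by
  constructor
  · rintro ⟨e, h1, h2⟩
    exact ⟨⟨_, h1⟩, ⟨_, h2⟩⟩
  · rintro ⟨⟨a, h1⟩, ⟨b, h2⟩⟩
    exact ⟨Nat.pair a b, by simpa using h1, by simpa using h2⟩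

theorem bitrade_tripleProd {T T' S S' : Finset (ℕ × ℕ × ℕ)} (hT : IsLatinBitrade T T')
    (hS : IsLatinBitrade S S') : IsLatinBitrade (tripleProd T S) (tripleProd T' S') := by
  obtain ⟨p, p', d, t1, t2, t3⟩ := hT
  obtain ⟨q, q', -, s1, s2, s3⟩ := hS
  refine ⟨pls_tripleProd p q, pls_tripleProd p' q', ?_, ?_, ?_, ?_⟩
  · rw [Finset.disjoint_left] at d ⊢
    rintro ⟨r, c, e⟩ h h'
    rw [mem_tripleProd] at h h'
    exact d h.1 h'.1
  · intro r c
    simp only [mem_tripleProd]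
    rw [exists_unpair (fun e => (_, _, e) ∈ T) (fun e => (_, _, e) ∈ S),
      exists_unpair (fun e => (_, _, e) ∈ T') (fun e => (_, _, e) ∈ S'), t1, s1]
  · intro r e
    simp only [mem_tripleProd]
    rw [exists_unpair (fun c => (_, c, _) ∈ T) (fun c => (_, c, _) ∈ S),
      exists_unpair (fun c => (_, c, _) ∈ T') (fun c => (_, c, _) ∈ S'), t2, s2]
  · intro c e
    simp only [mem_tripleProd]
    rw [exists_unpair (fun r => (r, _, _) ∈ T) (fun r => (r, _, _) ∈ S),
      exists_unpair (fun r => (r, _, _) ∈ T') (fun r => (r, _, _) ∈ S'), t3, s3]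

theorem stmt_4 (k l m n : ℕ) (hk : 0 < k) (hl : 0 < l) (hm : k ≤ m) (hn : l ≤ n)
    (h1 : ∃ T T' : Finset (ℕ × ℕ × ℕ),
      IsHomogeneousLatinBitrade k T T' ∧ T.card = k * m)
    (h2 : ∃ T T' : Finset (ℕ × ℕ × ℕ),
      IsHomogeneousLatinBitrade l T T' ∧ T.card = l * n) :
    ∃ T T' : Finset (ℕ × ℕ × ℕ),
      IsHomogeneousLatinBitrade (k * l) T T' ∧ T.card = (k * l) * (m * n) := by
  obtain ⟨T, T', ⟨hT, t1, t2, t3⟩, cT⟩ := h1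
  obtain ⟨S, S', ⟨hS, s1, s2, s3⟩, cS⟩ := h2
  refine ⟨tripleProd T S, tripleProd T' S', ⟨bitrade_tripleProd hT hS, ?_, ?_, ?_⟩, ?_⟩
  · rintro r ⟨⟨a, b, d⟩, hx, rfl⟩
    rw [mem_tripleProd] at hx
    rw [← t1 _ ⟨_, hx.1, rfl⟩, ← s1 _ ⟨_, hx.2, rfl⟩, ← card_tripleProd]
    congr 1
    ext ⟨u, v, w⟩
    simp only [Finset.mem_filter, mem_tripleProd]
    rw [unpair_eq_iff]
    tauto
  · rintro r ⟨⟨a, b, d⟩, hx, rfl⟩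
    rw [mem_tripleProd] at hx
    rw [← t2 _ ⟨_, hx.1, rfl⟩, ← s2 _ ⟨_, hx.2, rfl⟩, ← card_tripleProd]
    congr 1
    ext ⟨u, v, w⟩
    simp only [Finset.mem_filter, mem_tripleProd]
    rw [unpair_eq_iff]
    tauto
  · rintro r ⟨⟨a, b, d⟩, hx, rfl⟩
    rw [mem_tripleProd] at hx
    rw [← t3 _ ⟨_, hx.1, rfl⟩, ← s3 _ ⟨_, hx.2, rfl⟩, ← card_tripleProd]
    congr 1
    ext ⟨u, v, w⟩
    simp only [Finset.mem_filter, mem_tripleProd]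
    rw [unpair_eq_iff]
    tauto
  · rw [card_tripleProd, cT, cS]
    ring
end

section
/- For every integer k with k ≥ 3, there exists a k-homogeneous Latin bitrade of volume k·(k+6). -/
/-- Existence of a `k`-homogeneous bitrade of volume `k * m`. -/
def HomExists (k m : ℕ) : Prop :=
  ∃ T T' : Finset (ℕ × ℕ × ℕ), IsHomogeneousLatinBitrade k T T' ∧ T.card = k * m

/-- Circulant array with base row `i ↦ f i` in columns `0, …, k-1`. -/
def circ (k m : ℕ) [NeZero m] (f : ℕ → ℕ) : Finset (ℕ × ℕ × ℕ) :=
  ((Finset.univ : Finset (ZMod m)) ×ˢ Finset.range k).image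
    (fun p => (p.1.val, (p.1 + (p.2 : ZMod m)).val, (p.1 + (f p.2 : ZMod m)).val))

lemma mem_circ {k m : ℕ} [NeZero m] {f : ℕ → ℕ} {x : ℕ × ℕ × ℕ} :
    x ∈ circ k m f ↔ ∃ r : ZMod m, ∃ i < k,
      x = (r.val, (r + (i : ZMod m)).val, (r + (f i : ZMod m)).val) := by
  simp only [circ, Finset.mem_image, Finset.mem_product, Finset.mem_univ, true_and,
    Finset.mem_range, Prod.exists]
  constructor
  · rintro ⟨r, i, hi, h⟩
    exact ⟨r, i, hi, h.symm⟩
  · rintro ⟨r, i, hi, h⟩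
    exact ⟨r, i, hi, h.symm⟩

lemma cast_inj_of_lt {m : ℕ} (a b : ℤ) (h1 : a - b < m) (h2 : b - a < m)
    (h : (a : ZMod m) = b) : a = b := by
  rw [ZMod.intCast_eq_intCast_iff_dvd_sub] at h
  have := Int.eq_zero_of_abs_lt_dvd h (by rw [abs_lt]; constructor <;> linarith)
  linarith

lemma nat_cast_inj {m : ℕ} {a b : ℕ} (h1 : a < m) (h2 : b < m)
    (h : (a : ZMod m) = b) : a = b := by
  have := cast_inj_of_lt (m := m) (a : ℤ) b (by omega) (by omega) (by exact_mod_cast h)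
  exact_mod_cast this

/-- Base-row condition. -/
structure Good (k : ℕ) (f : ℕ → ℕ) : Prop where
  lt : ∀ i < k, f i < k
  inj : ∀ i < k, ∀ j < k, f i = f j → i = j
  lo : ∀ i < k, -(k : ℤ) ≤ 2 * ((f i : ℤ) - i)
  hi : ∀ i < k, 2 * ((f i : ℤ) - i) ≤ k
  dinj : ∀ i < k, ∀ j < k, (f i : ℤ) - i = f j - j → i = j

lemma Good.cast {k m : ℕ} {f : ℕ → ℕ} (hf : Good k f) (hm : k < m) {i j : ℕ} (hi : i < k)
    (hj : j < k) (h : (f i : ZMod m) - i = f j - j) : i = j := by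
  apply hf.dinj i hi j hj
  have := hf.lo i hi
  have := hf.hi i hi
  have := hf.lo j hj
  have := hf.hi j hj
  apply cast_inj_of_lt (m := m) _ _ (by omega) (by omega)
  push_cast
  exact h

lemma Good.pls {k m : ℕ} [NeZero m] {f : ℕ → ℕ} (hf : Good k f) (hm : k < m) :
    IsPartialLatinSquare (circ k m f) := by
  refine ⟨?_, ?_, ?_⟩
  · intro x hx y hy h1 h2
    obtain ⟨r, i, hi, rfl⟩ := mem_circ.1 hx
    obtain ⟨s, j, hj, rfl⟩ := mem_circ.1 hy
    have h1 := ZMod.val_injective m h1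
    have h2 := ZMod.val_injective m h2
    subst h1
    have := nat_cast_inj (by omega) (by omega) (add_left_cancel h2)
    subst this
    rfl
  · intro x hx y hy h1 h2
    obtain ⟨r, i, hi, rfl⟩ := mem_circ.1 hx
    obtain ⟨s, j, hj, rfl⟩ := mem_circ.1 hy
    have h1 := ZMod.val_injective m h1
    have h2 := ZMod.val_injective m h2
    subst h1
    have := nat_cast_inj (by have := hf.lt i hi; omega) (by have := hf.lt j hj; omega)
      (add_left_cancel h2)
    have := hf.inj i hi j hj this
    subst this
    rfl
  · intro x hx y hy h1 h2
    obtain ⟨r, i, hi, rfl⟩ := mem_circ.1 hx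
    obtain ⟨s, j, hj, rfl⟩ := mem_circ.1 hy
    have h1 := ZMod.val_injective m h1
    have h2 := ZMod.val_injective m h2
    have : i = j := hf.cast hm hi hj (by linear_combination h2 - h1)
    subst this
    have := add_right_cancel h1
    subst this
    rfl

lemma Good.surj {k : ℕ} {f : ℕ → ℕ} (hf : Good k f) {e : ℕ} (he : e < k) :
    ∃ i < k, f i = e := by
  have h := Finset.surj_on_of_inj_on_of_card_le (s := Finset.range k) (t := Finset.range k)
    (fun i _ => f i) (fun i hi => by simpa using hf.lt i (by simpa using hi))
    (fun i j hi hj h => hf.inj i (by simpa using hi) j (by simpa using hj) h) le_rfl e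
    (by simpa using he)
  obtain ⟨i, hi, h⟩ := h
  exact ⟨i, by simpa using hi, h.symm⟩

lemma circ_cells {k m : ℕ} [NeZero m] {f g : ℕ → ℕ} (r c : ℕ)
    (h : ∃ e, (r, c, e) ∈ circ k m f) : ∃ e, (r, c, e) ∈ circ k m g := by
  obtain ⟨e, he⟩ := h
  obtain ⟨s, i, hi, h⟩ := mem_circ.1 he
  simp only [Prod.mk.injEq] at h
  exact ⟨_, mem_circ.2 ⟨s, i, hi, by rw [h.1, h.2.1]⟩⟩

lemma circ_rows {k m : ℕ} [NeZero m] {f g : ℕ → ℕ} (hf : Good k f) (hg : Good k g) (r e : ℕ)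
    (h : ∃ c, (r, c, e) ∈ circ k m f) : ∃ c, (r, c, e) ∈ circ k m g := by
  obtain ⟨c, hc⟩ := h
  obtain ⟨s, i, hi, h⟩ := mem_circ.1 hc
  simp only [Prod.mk.injEq] at h
  obtain ⟨j, hj, hij⟩ := hg.surj (hf.lt i hi)
  exact ⟨_, mem_circ.2 ⟨s, j, hj, by rw [h.1, h.2.2, hij]⟩⟩

lemma circ_cols {k m : ℕ} [NeZero m] {f g : ℕ → ℕ}
    (hd : ∀ i < k, ∃ j < k, (g j : ℤ) - j = f i - i) (c e : ℕ)
    (h : ∃ r, (r, c, e) ∈ circ k m f) : ∃ r, (r, c, e) ∈ circ k m g := by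
  obtain ⟨r, hr⟩ := h
  obtain ⟨s, i, hi, h⟩ := mem_circ.1 hr
  simp only [Prod.mk.injEq] at h
  obtain ⟨j, hj, hij⟩ := hd i hi
  have hij' : (g j : ZMod m) - j = f i - i := by
    have := congrArg (Int.cast : ℤ → ZMod m) hij
    push_cast at this
    exact this
  refine ⟨(s + i - j : ZMod m).val, mem_circ.2 ⟨s + i - j, j, hj, ?_⟩⟩
  rw [h.2.1, h.2.2]
  congr 3
  · ring
  · linear_combination -hij'

lemma circ_bitrade {k m : ℕ} [NeZero m] {f g : ℕ → ℕ} (hf : Good k f) (hg : Good k g)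
    (hm : k < m)
    (hd : ∀ i < k, ∃ j < k, (g j : ℤ) - j = f i - i)
    (hd' : ∀ i < k, ∃ j < k, (f j : ℤ) - j = g i - i)
    (hne : ∀ i < k, f i ≠ g i) : IsLatinBitrade (circ k m f) (circ k m g) := by
  refine ⟨hf.pls hm, hg.pls hm, ?_, fun r c => ⟨circ_cells r c, circ_cells r c⟩,
    fun r e => ⟨circ_rows hf hg r e, circ_rows hg hf r e⟩,
    fun c e => ⟨circ_cols hd c e, circ_cols hd' c e⟩⟩
  rw [Finset.disjoint_left]
  intro x hx hy
  obtain ⟨r, i, hi, rfl⟩ := mem_circ.1 hx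
  obtain ⟨s, j, hj, h⟩ := mem_circ.1 hy
  simp only [Prod.mk.injEq] at h
  obtain ⟨h1, h2, h3⟩ := h
  have h1 := ZMod.val_injective m h1
  have h2 := ZMod.val_injective m h2
  have h3 := ZMod.val_injective m h3
  subst h1
  have := nat_cast_inj (by omega) (by omega) (add_left_cancel h2)
  subst this
  exact hne i hi (nat_cast_inj (by have := hf.lt i hi; omega) (by have := hg.lt i hi; omega)
    (add_left_cancel h3))

lemma circ_inj {k m : ℕ} [NeZero m] {f : ℕ → ℕ} (hm : k < m) {r s : ZMod m} {i j : ℕ}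
    (hi : i < k) (hj : j < k)
    (h : (r.val, (r + (i : ZMod m)).val, (r + (f i : ZMod m)).val)
      = (s.val, (s + (j : ZMod m)).val, (s + (f j : ZMod m)).val)) : r = s ∧ i = j := by
  simp only [Prod.mk.injEq] at h
  have h1 := ZMod.val_injective m h.1
  have h2 := ZMod.val_injective m h.2.1
  subst h1
  exact ⟨rfl, nat_cast_inj (by omega) (by omega) (add_left_cancel h2)⟩

lemma circ_card {k m : ℕ} [NeZero m] {f : ℕ → ℕ} (hm : k < m) :
    (circ k m f).card = k * m := by
  rw [circ, Finset.card_image_of_injOn]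
  · simp [ZMod.card, mul_comm]
  · rintro ⟨r, i⟩ hi ⟨s, j⟩ hj h
    have := circ_inj hm (by simpa using hi) (by simpa using hj) h
    exact Prod.ext this.1 this.2

lemma circ_fiber {k m : ℕ} [NeZero m] {f : ℕ → ℕ} (hm : k < m) (p : ℕ × ℕ × ℕ → ℕ)
    (q : ℕ → ZMod m) (v : ℕ)
    (hq : ∀ (r : ZMod m), ∀ i < k,
      p (r.val, (r + (i : ZMod m)).val, (r + (f i : ZMod m)).val) = v ↔ r = q i) :
    ((circ k m f).filter (fun x => p x = v)).card = k := by
  have : (circ k m f).filter (fun x => p x = v) = (Finset.range k).image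
      (fun i => ((q i).val, (q i + (i : ZMod m)).val, (q i + (f i : ZMod m)).val)) := by
    ext x
    simp only [Finset.mem_filter, mem_circ, Finset.mem_image, Finset.mem_range]
    constructor
    · rintro ⟨⟨r, i, hi, rfl⟩, h⟩
      rw [hq r i hi] at h
      exact ⟨i, hi, by rw [h]⟩
    · rintro ⟨i, hi, rfl⟩
      exact ⟨⟨q i, i, hi, rfl⟩, (hq _ i hi).2 rfl⟩
  rw [this, Finset.card_image_of_injOn, Finset.card_range]
  intro i hi j hj h
  exact (circ_inj hm (by simpa using hi) (by simpa using hj) h).2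

lemma circ_hom {k m : ℕ} {f g : ℕ → ℕ} (hf : Good k f) (hg : Good k g)
    (hm : k < m)
    (hd : ∀ i < k, ∃ j < k, (g j : ℤ) - j = f i - i)
    (hd' : ∀ i < k, ∃ j < k, (f j : ℤ) - j = g i - i)
    (hne : ∀ i < k, f i ≠ g i) : HomExists k m := by
  have : NeZero m := ⟨by omega⟩
  refine ⟨circ k m f, circ k m g, ⟨circ_bitrade hf hg hm hd hd' hne, ?_, ?_, ?_⟩, circ_card hm⟩
  · rintro v ⟨x, hx, h⟩
    obtain ⟨s, j, hj, rfl⟩ := mem_circ.1 hx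
    refine circ_fiber hm (fun x => x.1) (fun _ => s) v fun r i hi => ?_
    simp only [← h]
    exact (ZMod.val_injective m).eq_iff
  · rintro v ⟨x, hx, h⟩
    obtain ⟨s, j, hj, rfl⟩ := mem_circ.1 hx
    refine circ_fiber hm (fun x => x.2.1) (fun i => s + j - i) v fun r i hi => ?_
    simp only [← h]
    rw [(ZMod.val_injective m).eq_iff, eq_sub_iff_add_eq]
  · rintro v ⟨x, hx, h⟩
    obtain ⟨s, j, hj, rfl⟩ := mem_circ.1 hx
    refine circ_fiber hm (fun x => x.2.2) (fun i => s + f j - f i) v fun r i hi => ?_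
    simp only [← h]
    rw [(ZMod.val_injective m).eq_iff, eq_sub_iff_add_eq]

/-- Odd case: base rows `2i` and `2i+1` modulo `k`. -/
lemma hom_odd (h m : ℕ) (hh : 1 ≤ h) (hm : 2 * h + 1 < m) : HomExists (2 * h + 1) m := by
  refine circ_hom (f := fun i => if i ≤ h then 2 * i else 2 * i - (2 * h + 1))
    (g := fun i => if i < h then 2 * i + 1 else 2 * i - 2 * h) ?_ ?_ hm ?_ ?_ ?_
  · constructor <;> intros <;> grind
  · constructor <;> intros <;> grind
  · intro i hi
    by_cases h0 : i = 0
    · exact ⟨2 * h, by grind⟩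
    by_cases h1 : i ≤ h
    · exact ⟨i - 1, by grind⟩
    · exact ⟨i - 1, by grind⟩
  · intro i hi
    by_cases h0 : i = 2 * h
    · exact ⟨0, by grind⟩
    · exact ⟨i + 1, by grind⟩
  · intros
    grind

/-- Even case: doubling and halving modulo `k+1`. -/
lemma hom_even (h m : ℕ) (h3 : (2 * h) % 3 ≠ 2) (hm : 2 * h < m) : HomExists (2 * h) m := by
  refine circ_hom (f := fun i => if i < h then 2 * i + 1 else 2 * i - 2 * h)
    (g := fun i => if i % 2 = 1 then i / 2 else i / 2 + h) ?_ ?_ hm ?_ ?_ ?_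
  · constructor <;> intros <;> grind
  · constructor <;> intros <;> grind
  · intro i hi
    by_cases h1 : i < h
    · exact ⟨2 * (h - (i + 1)), by grind⟩
    · exact ⟨2 * (2 * h - i) - 1, by grind⟩
  · intro i hi
    by_cases h1 : i % 2 = 1
    · exact ⟨2 * h - (i / 2 + 1), by grind⟩
    · exact ⟨h - i / 2 - 1, by grind⟩
  · intros
    grind

/-- Product with the Latin square of order two. -/
def dbl (T : Finset (ℕ × ℕ × ℕ)) : Finset (ℕ × ℕ × ℕ) :=
  (T ×ˢ (Finset.range 2 ×ˢ Finset.range 2)).image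
    (fun p => (2 * p.1.1 + p.2.1, 2 * p.1.2.1 + p.2.2, 2 * p.1.2.2 + (p.2.1 + p.2.2) % 2))

lemma mem_dbl {T : Finset (ℕ × ℕ × ℕ)} {r c e : ℕ} :
    (r, c, e) ∈ dbl T ↔ (r / 2, c / 2, e / 2) ∈ T ∧ (r + c + e) % 2 = 0 := by
  simp only [dbl, Finset.mem_image, Finset.mem_product, Finset.mem_range, Prod.exists,
    Prod.mk.injEq]
  constructor
  · rintro ⟨x, y, z, a, b, ⟨hT, ha, hb⟩, rfl, rfl, rfl⟩
    refine ⟨?_, by omega⟩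
    convert hT using 3 <;> omega
  · rintro ⟨hT, h⟩
    exact ⟨r / 2, c / 2, e / 2, r % 2, c % 2, ⟨hT, by omega, by omega⟩, by omega, by omega,
      by omega⟩

lemma dbl_pls {T : Finset (ℕ × ℕ × ℕ)} (h : IsPartialLatinSquare T) :
    IsPartialLatinSquare (dbl T) := by
  obtain ⟨h1, h2, h3⟩ := h
  refine ⟨?_, ?_, ?_⟩
  · rintro ⟨r, c, e⟩ hx ⟨r', c', e'⟩ hy ha hb
    rw [mem_dbl] at hx hy
    simp only at ha hb
    subst ha hb
    have := h1 _ hx.1 _ hy.1 rfl rfl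
    simp only [Prod.mk.injEq, true_and] at this ⊢
    omega
  · rintro ⟨r, c, e⟩ hx ⟨r', c', e'⟩ hy ha hb
    rw [mem_dbl] at hx hy
    simp only at ha hb
    subst ha hb
    have := h2 _ hx.1 _ hy.1 rfl rfl
    simp only [Prod.mk.injEq, true_and, and_true] at this ⊢
    omega
  · rintro ⟨r, c, e⟩ hx ⟨r', c', e'⟩ hy ha hb
    rw [mem_dbl] at hx hy
    simp only at ha hb
    subst ha hb
    have := h3 _ hx.1 _ hy.1 rfl rfl
    simp only [Prod.mk.injEq, and_true] at this ⊢
    omega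

lemma dbl_ex1 {T : Finset (ℕ × ℕ × ℕ)} {r c : ℕ} :
    (∃ e, (r, c, e) ∈ dbl T) ↔ ∃ e, (r / 2, c / 2, e) ∈ T := by
  simp only [mem_dbl]
  constructor
  · rintro ⟨e, h, _⟩
    exact ⟨_, h⟩
  · rintro ⟨e, h⟩
    refine ⟨2 * e + (r + c) % 2, ?_, by omega⟩
    convert h using 3
    omega

lemma dbl_ex2 {T : Finset (ℕ × ℕ × ℕ)} {r e : ℕ} :
    (∃ c, (r, c, e) ∈ dbl T) ↔ ∃ c, (r / 2, c, e / 2) ∈ T := by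
  simp only [mem_dbl]
  constructor
  · rintro ⟨c, h, _⟩
    exact ⟨_, h⟩
  · rintro ⟨c, h⟩
    refine ⟨2 * c + (r + e) % 2, ?_, by omega⟩
    convert h using 3
    omega

lemma dbl_ex3 {T : Finset (ℕ × ℕ × ℕ)} {c e : ℕ} :
    (∃ r, (r, c, e) ∈ dbl T) ↔ ∃ r, (r, c / 2, e / 2) ∈ T := by
  simp only [mem_dbl]
  constructor
  · rintro ⟨r, h, _⟩
    exact ⟨_, h⟩
  · rintro ⟨r, h⟩
    refine ⟨2 * r + (c + e) % 2, ?_, by omega⟩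
    convert h using 2
    omega

lemma dbl_card (T : Finset (ℕ × ℕ × ℕ)) : (dbl T).card = T.card * 4 := by
  rw [dbl, Finset.card_image_of_injOn]
  · simp
  · rintro ⟨⟨x, y, z⟩, a, b⟩ h ⟨⟨x', y', z'⟩, a', b'⟩ h' he
    simp only [Finset.coe_product, Set.mem_prod, Finset.mem_coe, Finset.mem_range] at h h'
    simp only [Prod.mk.injEq] at he ⊢
    omega

lemma dbl_fiber (T : Finset (ℕ × ℕ × ℕ)) (p : ℕ × ℕ × ℕ → ℕ) (v k : ℕ)
    (q : (ℕ × ℕ × ℕ) × ℕ → ℕ × ℕ × ℕ)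
    (hq : ∀ t b, b < 2 → p t = v / 2 →
      p (q (t, b)) = v ∧ ((q (t, b)).1 + (q (t, b)).2.1 + (q (t, b)).2.2) % 2 = 0 ∧
      ((q (t, b)).1 / 2, (q (t, b)).2.1 / 2, (q (t, b)).2.2 / 2) = t)
    (hq2 : ∀ t, p t = v / 2 → q (t, 0) ≠ q (t, 1))
    (hq1 : ∀ r c e, p (r, c, e) = v → (r + c + e) % 2 = 0 →
      p (r / 2, c / 2, e / 2) = v / 2 ∧ ∃ b < 2, q ((r / 2, c / 2, e / 2), b) = (r, c, e))
    (hk : (T.filter (fun x => p x = v / 2)).card = k) :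
    ((dbl T).filter (fun x => p x = v)).card = 2 * k := by
  have : (dbl T).filter (fun x => p x = v)
      = ((T.filter (fun x => p x = v / 2)) ×ˢ Finset.range 2).image q := by
    ext ⟨r, c, e⟩
    simp only [Finset.mem_filter, mem_dbl, Finset.mem_image, Finset.mem_product, Finset.mem_range]
    constructor
    · rintro ⟨⟨hT, h0⟩, hv⟩
      obtain ⟨h1, b, hb, h2⟩ := hq1 r c e hv h0
      exact ⟨(_, b), ⟨⟨hT, h1⟩, hb⟩, h2⟩
    · rintro ⟨⟨t, b⟩, ⟨⟨hT, ht⟩, hb⟩, h⟩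
      obtain ⟨h1, h2, h3⟩ := hq t b hb ht
      rw [h] at h1 h2 h3
      exact ⟨⟨by rw [h3]; exact hT, h2⟩, h1⟩
  rw [this, Finset.card_image_of_injOn, Finset.card_product, hk, Finset.card_range, mul_comm]
  rintro ⟨t, b⟩ h ⟨t', b'⟩ h' he
  simp only [Finset.coe_product, Set.mem_prod, Finset.mem_coe, Finset.mem_range,
    Finset.mem_filter] at h h'
  have h1 := (hq t b h.2 h.1.2).2.2
  have h2 := (hq t' b' h'.2 h'.1.2).2.2
  rw [he, h2] at h1
  subst h1
  have h3 := hq2 _ h.1.2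
  obtain ⟨_, hb⟩ := h
  obtain ⟨_, hb'⟩ := h'
  interval_cases b <;> interval_cases b'
  · rfl
  · exact absurd he h3
  · exact absurd he.symm h3
  · rfl

lemma dbl_hom {k m : ℕ} (h : HomExists k m) : HomExists (2 * k) (2 * m) := by
  obtain ⟨T, T', ⟨⟨h1, h2, h3, h4, h5, h6⟩, hr, hc, he⟩, hcard⟩ := h
  refine ⟨dbl T, dbl T', ⟨⟨dbl_pls h1, dbl_pls h2, ?_, ?_, ?_, ?_⟩, ?_, ?_, ?_⟩, ?_⟩
  · rw [Finset.disjoint_left] at h3 ⊢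
    rintro ⟨r, c, e⟩ hx hy
    exact h3 (mem_dbl.1 hx).1 (mem_dbl.1 hy).1
  · intro r c
    rw [dbl_ex1, dbl_ex1, h4]
  · intro r e
    rw [dbl_ex2, dbl_ex2, h5]
  · intro c e
    rw [dbl_ex3, dbl_ex3, h6]
  · rintro v ⟨⟨r, c, e⟩, hx, rfl⟩
    refine dbl_fiber T (fun x => x.1) r k
      (fun p => (r, 2 * p.1.2.1 + p.2, 2 * p.1.2.2 + (r + p.2) % 2)) ?_ ?_ ?_
      (hr _ ⟨_, (mem_dbl.1 hx).1, rfl⟩)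
    · rintro ⟨x, y, z⟩ b hb hp
      simp only [Prod.mk.injEq, true_and, and_true] at hp ⊢
      refine ⟨?_, ?_, ?_, ?_⟩ <;> omega
    · rintro ⟨x, y, z⟩ hp
      simp
    · intro x y z hv h0
      simp only at hv
      subst hv
      refine ⟨rfl, y % 2, by omega, ?_⟩
      simp only [Prod.mk.injEq, true_and, and_true]
      constructor <;> omega
  · rintro v ⟨⟨r, c, e⟩, hx, rfl⟩
    refine dbl_fiber T (fun x => x.2.1) c k
      (fun p => (2 * p.1.1 + p.2, c, 2 * p.1.2.2 + (c + p.2) % 2)) ?_ ?_ ?_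
      (hc _ ⟨_, (mem_dbl.1 hx).1, rfl⟩)
    · rintro ⟨x, y, z⟩ b hb hp
      simp only [Prod.mk.injEq, true_and, and_true] at hp ⊢
      refine ⟨?_, ?_, ?_, ?_⟩ <;> omega
    · rintro ⟨x, y, z⟩ hp
      simp
    · intro x y z hv h0
      simp only at hv
      subst hv
      refine ⟨rfl, x % 2, by omega, ?_⟩
      simp only [Prod.mk.injEq, true_and, and_true]
      constructor <;> omega
  · rintro v ⟨⟨r, c, e⟩, hx, rfl⟩
    refine dbl_fiber T (fun x => x.2.2) e k
      (fun p => (2 * p.1.1 + p.2, 2 * p.1.2.1 + (e + p.2) % 2, e)) ?_ ?_ ?_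
      (he _ ⟨_, (mem_dbl.1 hx).1, rfl⟩)
    · rintro ⟨x, y, z⟩ b hb hp
      simp only [Prod.mk.injEq, true_and, and_true] at hp ⊢
      refine ⟨?_, ?_, ?_, ?_⟩ <;> omega
    · rintro ⟨x, y, z⟩ hp
      simp
    · intro x y z hv h0
      simp only at hv
      subst hv
      refine ⟨rfl, x % 2, by omega, ?_⟩
      simp only [Prod.mk.injEq, true_and, and_true]
      constructor <;> omega
  · rw [dbl_card, hcard]
    ring

lemma hom_base (k m : ℕ) (hk : 3 ≤ k) (h : k % 2 = 1 ∨ k % 3 ≠ 2) (hm : k < m) :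
    HomExists k m := by
  rcases Nat.even_or_odd' k with ⟨l, rfl | rfl⟩
  · exact hom_even l m (by omega) hm
  · exact hom_odd l m (by omega) hm

theorem stmt_6 (k : ℕ) (hk : 3 ≤ k) :
    ∃ T T' : Finset (ℕ × ℕ × ℕ),
      IsHomogeneousLatinBitrade k T T' ∧ T.card = k * (k + 6) := by
  change HomExists k (k + 6)
  by_cases h : k % 2 = 1 ∨ k % 3 ≠ 2
  · exact hom_base k _ hk h (by omega)
  · have := dbl_hom (hom_base (k / 2) (k / 2 + 3) (by omega) (by omega) (by omega))
    have h1 : 2 * (k / 2) = k := by omega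
    have h2 : 2 * (k / 2 + 3) = k + 6 := by omega
    rwa [h1, h2] at this
end

section
/- Let k ≥ 3 be an integer that is divisible by 3 or divisible by 5. Then for every integer m with m ≥ k, there exists a k-homogeneous Latin bitrade of volume k·m. -/
/-- residue of an integer as a natural number -/
def mdN (m : ℕ) (a : ℤ) : ℕ := (a % (m : ℤ)).toNat

theorem mdN_lt {m : ℕ} (hm : 0 < m) (a : ℤ) : mdN m a < m := by
  have h1 := Int.emod_nonneg a (b := (m : ℤ)) (by omega)
  have h2 := Int.emod_lt_of_pos a (b := (m : ℤ)) (by omega)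
  unfold mdN; omega

theorem mdN_dvd {m : ℕ} (hm : 0 < m) (a : ℤ) : (m : ℤ) ∣ (mdN m a : ℤ) - a := by
  have h1 := Int.emod_nonneg a (b := (m : ℤ)) (by omega)
  have h2 := Int.mul_ediv_add_emod a (m : ℤ)
  refine ⟨-(a / m), ?_⟩
  have : (mdN m a : ℤ) = a % m := by unfold mdN; omega
  rw [this]; linarith

theorem dvd_small {m a b : ℤ} (h : m ∣ a - b) (h1 : a - b < m) (h2 : b - a < m) : a = b := by
  have := Int.eq_zero_of_abs_lt_dvd h (abs_lt.2 ⟨by linarith, h1⟩)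
  linarith

theorem mdN_uniq {m : ℕ} {c : ℕ} (hc : c < m) {a : ℤ} (h : (m : ℤ) ∣ (c : ℤ) - a) :
    c = mdN m a := by
  have hm : 0 < m := by omega
  have h1 := mdN_lt hm a
  have h2 := mdN_dvd hm a
  have h3 : (m : ℤ) ∣ (c : ℤ) - (mdN m a : ℤ) := by
    have := dvd_sub h h2
    simpa using this
  have := dvd_small h3 (by omega) (by omega)
  exact_mod_cast this

/-- A non-attacking placement in the hexagon of side `n + 1`. -/
structure Hex (n : ℕ) (f : ℤ → ℤ) : Prop where
  b1 : ∀ x : ℤ, -n ≤ x → x ≤ n → -n ≤ f x ∧ f x ≤ n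
  b2 : ∀ x : ℤ, -n ≤ x → x ≤ n → -n ≤ x + f x ∧ x + f x ≤ n
  i1 : ∀ x y : ℤ, -n ≤ x → x ≤ n → -n ≤ y → y ≤ n → f x = f y → x = y
  i2 : ∀ x y : ℤ, -n ≤ x → x ≤ n → -n ≤ y → y ≤ n → x + f x = y + f y → x = y

/-- The circulant partial Latin square with base row given by `f` on `X`. -/
def Tr (m : ℕ) (X : Finset ℤ) (f : ℤ → ℤ) : Finset (ℕ × ℕ × ℕ) :=
  (Finset.range m ×ˢ X).image
    (fun p => (p.1, mdN m (p.1 + p.2), mdN m (p.1 + p.2 + f p.2)))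

theorem mem_Tr {m : ℕ} {X : Finset ℤ} {f : ℤ → ℤ} {r c e : ℕ} :
    (r, c, e) ∈ Tr m X f ↔ r < m ∧ c < m ∧ e < m ∧
      ∃ x ∈ X, (m : ℤ) ∣ (c : ℤ) - r - x ∧ (m : ℤ) ∣ (e : ℤ) - c - f x := by
  unfold Tr
  simp only [Finset.mem_image, Finset.mem_product, Finset.mem_range, Prod.mk.injEq, Prod.exists]
  constructor
  · rintro ⟨r', x, ⟨hr, hx⟩, rfl, rfl, rfl⟩
    have hm : 0 < m := by omega
    refine ⟨hr, mdN_lt hm _, mdN_lt hm _, x, hx, ?_, ?_⟩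
    · have := mdN_dvd hm ((r' : ℤ) + x)
      rwa [sub_sub]
    · have h1 := mdN_dvd hm ((r' : ℤ) + x)
      have h2 := mdN_dvd hm ((r' : ℤ) + x + f x)
      have := dvd_sub h2 h1
      ring_nf at this ⊢
      exact this
  · rintro ⟨hr, hc, he, x, hx, h1, h2⟩
    refine ⟨r, x, ⟨hr, hx⟩, rfl, ?_, ?_⟩
    · exact (mdN_uniq hc (by rwa [← sub_sub])).symm
    · refine (mdN_uniq he ?_).symm
      have := dvd_add h1 h2
      ring_nf at this ⊢
      exact this

section
variable {m n : ℕ} {X : Finset ℤ} {f : ℤ → ℤ}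

theorem Tr_pls (hm : 2 * n + 1 ≤ m) (hX : ∀ x ∈ X, -(n : ℤ) ≤ x ∧ x ≤ n) (hf : Hex n f) :
    IsPartialLatinSquare (Tr m X f) := by
  refine ⟨?_, ?_, ?_⟩
  · rintro ⟨r, c, e⟩ h1 ⟨r', c', e'⟩ h2 hr hc
    simp only at hr hc
    subst hr hc
    obtain ⟨a1, a2, a3, x, hx, d1, d2⟩ := mem_Tr.1 h1
    obtain ⟨b1, b2, b3, y, hy, d3, d4⟩ := mem_Tr.1 h2
    have hx' := hX x hx
    have hy' := hX y hy
    have : x = y := by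
      refine dvd_small (m := m) ?_ (by omega) (by omega)
      have := dvd_sub d3 d1
      ring_nf at this ⊢
      exact this
    subst this
    have : (e : ℤ) = e' := by
      refine dvd_small (m := m) ?_ (by omega) (by omega)
      have := dvd_sub d2 d4
      ring_nf at this ⊢
      exact this
    have : e = e' := by exact_mod_cast this
    rw [this]
  · rintro ⟨r, c, e⟩ h1 ⟨r', c', e'⟩ h2 hr hc
    simp only at hr hc
    subst hr hc
    obtain ⟨a1, a2, a3, x, hx, d1, d2⟩ := mem_Tr.1 h1
    obtain ⟨b1, b2, b3, y, hy, d3, d4⟩ := mem_Tr.1 h2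
    have hx' := hX x hx
    have hy' := hX y hy
    have e1 := hf.b2 x hx'.1 hx'.2
    have e2 := hf.b2 y hy'.1 hy'.2
    have : x = y := by
      refine hf.i2 x y hx'.1 hx'.2 hy'.1 hy'.2 (dvd_small (m := m) ?_ (by omega) (by omega))
      have := dvd_sub (dvd_add d3 d4) (dvd_add d1 d2)
      ring_nf at this ⊢
      exact this
    subst this
    have : (c : ℤ) = c' := by
      refine dvd_small (m := m) ?_ (by omega) (by omega)
      have := dvd_sub d1 d3
      ring_nf at this ⊢
      exact this
    have : c = c' := by exact_mod_cast this
    rw [this]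
  · rintro ⟨r, c, e⟩ h1 ⟨r', c', e'⟩ h2 hr hc
    simp only at hr hc
    subst hr hc
    obtain ⟨a1, a2, a3, x, hx, d1, d2⟩ := mem_Tr.1 h1
    obtain ⟨b1, b2, b3, y, hy, d3, d4⟩ := mem_Tr.1 h2
    have hx' := hX x hx
    have hy' := hX y hy
    have e1 := hf.b1 x hx'.1 hx'.2
    have e2 := hf.b1 y hy'.1 hy'.2
    have : x = y := by
      refine hf.i1 x y hx'.1 hx'.2 hy'.1 hy'.2 (dvd_small (m := m) ?_ (by omega) (by omega))
      have := dvd_sub d4 d2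
      ring_nf at this ⊢
      exact this
    subst this
    have : (r : ℤ) = r' := by
      refine dvd_small (m := m) ?_ (by omega) (by omega)
      have := dvd_sub d3 d1
      ring_nf at this ⊢
      exact this
    have : r = r' := by exact_mod_cast this
    rw [this]

theorem mdN_inj {a b : ℤ} (hm : 0 < m) (h : mdN m a = mdN m b) : (m : ℤ) ∣ a - b := by
  have h1 := mdN_dvd hm a
  have h2 := mdN_dvd hm b
  rw [h] at h1
  have := dvd_sub h2 h1
  ring_nf at this ⊢
  exact this

theorem Tr_rc {r c : ℕ} : (∃ e, (r, c, e) ∈ Tr m X f) ↔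
    r < m ∧ c < m ∧ ∃ x ∈ X, (m : ℤ) ∣ (c : ℤ) - r - x := by
  constructor
  · rintro ⟨e, h⟩
    obtain ⟨a1, a2, a3, x, hx, d1, d2⟩ := mem_Tr.1 h
    exact ⟨a1, a2, x, hx, d1⟩
  · rintro ⟨a1, a2, x, hx, d1⟩
    refine ⟨mdN m (c + f x), mem_Tr.2 ⟨a1, a2, mdN_lt (by omega) _, x, hx, d1, ?_⟩⟩
    rw [sub_sub]
    exact mdN_dvd (by omega) _

theorem Tr_re {r e : ℕ} : (∃ c, (r, c, e) ∈ Tr m X f) ↔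
    r < m ∧ e < m ∧ ∃ w ∈ X.image (fun x => x + f x), (m : ℤ) ∣ (e : ℤ) - r - w := by
  simp only [Finset.mem_image, exists_exists_and_eq_and]
  constructor
  · rintro ⟨c, h⟩
    obtain ⟨a1, a2, a3, x, hx, d1, d2⟩ := mem_Tr.1 h
    refine ⟨a1, a3, x, hx, ?_⟩
    have := dvd_add d1 d2
    ring_nf at this ⊢
    exact this
  · rintro ⟨a1, a2, x, hx, d1⟩
    have h := mdN_dvd (m := m) (by omega) ((r : ℤ) + x)
    refine ⟨mdN m (r + x), mem_Tr.2 ⟨a1, mdN_lt (by omega) _, a2, x, hx, ?_, ?_⟩⟩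
    · rw [sub_sub]; exact h
    · have := dvd_sub d1 h
      ring_nf at this ⊢
      exact this

theorem Tr_ce {c e : ℕ} : (∃ r, (r, c, e) ∈ Tr m X f) ↔
    c < m ∧ e < m ∧ ∃ w ∈ X.image f, (m : ℤ) ∣ (e : ℤ) - c - w := by
  simp only [Finset.mem_image, exists_exists_and_eq_and]
  constructor
  · rintro ⟨r, h⟩
    obtain ⟨a1, a2, a3, x, hx, d1, d2⟩ := mem_Tr.1 h
    exact ⟨a2, a3, x, hx, d2⟩
  · rintro ⟨a1, a2, x, hx, d1⟩
    have h := mdN_dvd (m := m) (by omega) ((c : ℤ) - x)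
    refine ⟨mdN m (c - x), mem_Tr.2 ⟨mdN_lt (by omega) _, a1, a2, x, hx, ?_, d1⟩⟩
    have := (dvd_neg.2 h)
    ring_nf at this ⊢
    exact this

theorem Tr_card (hm : 2 * n + 1 ≤ m) (hX : ∀ x ∈ X, -(n : ℤ) ≤ x ∧ x ≤ n) :
    (Tr m X f).card = X.card * m := by
  unfold Tr
  rw [Finset.card_image_of_injOn, Finset.card_product, Finset.card_range, mul_comm]
  rintro ⟨r, x⟩ h1 ⟨r', y⟩ h2 h
  simp only [Finset.coe_product, Set.mem_prod, Finset.mem_coe, Finset.mem_range] at h1 h2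
  simp only [Prod.mk.injEq] at h
  obtain ⟨rfl, h, -⟩ := h
  have hx' := hX x h1.2
  have hy' := hX y h2.2
  have := dvd_small (mdN_inj (by omega) h) (by omega) (by omega)
  have : x = y := by omega
  rw [this]

theorem Tr_row (hm : 2 * n + 1 ≤ m) (hX : ∀ x ∈ X, -(n : ℤ) ≤ x ∧ x ≤ n) {r : ℕ} (hr : r < m) :
    ((Tr m X f).filter (fun x => x.1 = r)).card = X.card := by
  have : (Tr m X f).filter (fun x => x.1 = r) =
      X.image (fun x => (r, mdN m (r + x), mdN m (r + x + f x))) := by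
    ext ⟨r', c, e⟩
    simp only [Tr, Finset.mem_filter, Finset.mem_image, Finset.mem_product, Finset.mem_range,
      Prod.mk.injEq, Prod.exists]
    constructor
    · rintro ⟨⟨a, b, h, rfl, h2, h3⟩, rfl⟩
      exact ⟨b, h.2, rfl, h2, h3⟩
    · rintro ⟨b, h, rfl, h2, h3⟩
      exact ⟨⟨r, b, ⟨hr, h⟩, rfl, h2, h3⟩, rfl⟩
  rw [this, Finset.card_image_of_injOn]
  intro x h1 y h2 h
  simp only [Prod.mk.injEq] at h
  have hx' := hX x h1
  have hy' := hX y h2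
  have := dvd_small (mdN_inj (by omega) h.2.1) (by omega) (by omega)
  omega

theorem Tr_col (hm : 2 * n + 1 ≤ m) (hX : ∀ x ∈ X, -(n : ℤ) ≤ x ∧ x ≤ n) {c : ℕ} (hc : c < m) :
    ((Tr m X f).filter (fun x => x.2.1 = c)).card = X.card := by
  have hm0 : 0 < m := by omega
  have : (Tr m X f).filter (fun x => x.2.1 = c) =
      X.image (fun x => (mdN m (c - x), c, mdN m (c + f x))) := by
    ext ⟨r, c', e⟩
    rw [Finset.mem_filter, mem_Tr]
    simp only [Finset.mem_image, Prod.mk.injEq]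
    constructor
    · rintro ⟨⟨a1, a2, a3, x, hx, d1, d2⟩, rfl⟩
      refine ⟨x, hx, (mdN_uniq a1 ?_).symm, rfl, (mdN_uniq a3 ?_).symm⟩
      · have := (dvd_neg.2 d1)
        ring_nf at this ⊢
        exact this
      · rwa [← sub_sub]
    · rintro ⟨x, hx, rfl, rfl, rfl⟩
      refine ⟨⟨mdN_lt hm0 _, hc, mdN_lt hm0 _, x, hx, ?_, ?_⟩, rfl⟩
      · have := (dvd_neg.2 (mdN_dvd hm0 ((c : ℤ) - x)))
        ring_nf at this ⊢
        exact this
      · rw [sub_sub]; exact mdN_dvd hm0 _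
  rw [this, Finset.card_image_of_injOn]
  intro x h1 y h2 h
  simp only [Prod.mk.injEq] at h
  have hx' := hX x h1
  have hy' := hX y h2
  have := dvd_small (mdN_inj (by omega) h.1) (by omega) (by omega)
  omega

theorem Tr_ent (hm : 2 * n + 1 ≤ m) (hX : ∀ x ∈ X, -(n : ℤ) ≤ x ∧ x ≤ n) (hf : Hex n f)
    {e : ℕ} (he : e < m) :
    ((Tr m X f).filter (fun x => x.2.2 = e)).card = X.card := by
  have hm0 : 0 < m := by omega
  have : (Tr m X f).filter (fun x => x.2.2 = e) =
      X.image (fun x => (mdN m (e - f x - x), mdN m (e - f x), e)) := by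
    ext ⟨r, c, e'⟩
    rw [Finset.mem_filter, mem_Tr]
    simp only [Finset.mem_image, Prod.mk.injEq]
    constructor
    · rintro ⟨⟨a1, a2, a3, x, hx, d1, d2⟩, rfl⟩
      refine ⟨x, hx, (mdN_uniq a1 ?_).symm, (mdN_uniq a2 ?_).symm, rfl⟩
      · have := (dvd_neg.2 (dvd_add d1 d2))
        ring_nf at this ⊢
        exact this
      · have := (dvd_neg.2 d2)
        ring_nf at this ⊢
        exact this
    · rintro ⟨x, hx, rfl, rfl, rfl⟩
      have k1 := mdN_dvd hm0 ((e : ℤ) - f x - x)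
      have k2 := mdN_dvd hm0 ((e : ℤ) - f x)
      refine ⟨⟨mdN_lt hm0 _, mdN_lt hm0 _, he, x, hx, ?_, ?_⟩, rfl⟩
      · have := dvd_sub k2 k1
        ring_nf at this ⊢
        exact this
      · have := (dvd_neg.2 k2)
        ring_nf at this ⊢
        exact this
  rw [this, Finset.card_image_of_injOn]
  intro x h1 y h2 h
  simp only [Prod.mk.injEq] at h
  have hx' := hX x h1
  have hy' := hX y h2
  have e1 := hf.b1 x hx'.1 hx'.2
  have e2 := hf.b1 y hy'.1 hy'.2
  have := dvd_small (mdN_inj (by omega) h.2.1) (by omega) (by omega)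
  exact hf.i1 x y hx'.1 hx'.2 hy'.1 hy'.2 (by omega)

end

theorem circ_s9 {m n : ℕ} {X : Finset ℤ} {f g : ℤ → ℤ} (hm : 2 * n + 1 ≤ m)
    (hX : ∀ x ∈ X, -(n : ℤ) ≤ x ∧ x ≤ n) (hf : Hex n f) (hg : Hex n g)
    (hd : ∀ x ∈ X, f x ≠ g x) (h1 : X.image f = X.image g)
    (h2 : X.image (fun x => x + f x) = X.image (fun x => x + g x)) :
    ∃ T T' : Finset (ℕ × ℕ × ℕ),
        IsHomogeneousLatinBitrade X.card T T' ∧ T.card = X.card * m := by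
  refine ⟨Tr m X f, Tr m X g, ⟨⟨Tr_pls hm hX hf, Tr_pls hm hX hg, ?_, ?_, ?_, ?_⟩, ?_, ?_, ?_⟩,
    Tr_card hm hX⟩
  · rw [Finset.disjoint_left]
    rintro ⟨r, c, e⟩ k1 k2
    obtain ⟨a1, a2, a3, x, hx, d1, d2⟩ := mem_Tr.1 k1
    obtain ⟨b1, b2, b3, y, hy, d3, d4⟩ := mem_Tr.1 k2
    have hx' := hX x hx
    have hy' := hX y hy
    have : x = y := by
      refine dvd_small (m := m) ?_ (by omega) (by omega)
      have := dvd_sub d3 d1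
      ring_nf at this ⊢
      exact this
    subst this
    have e1 := hf.b1 x hx'.1 hx'.2
    have e2 := hg.b1 x hx'.1 hx'.2
    refine hd x hx (dvd_small (m := m) ?_ (by omega) (by omega))
    have := dvd_sub d4 d2
    ring_nf at this ⊢
    exact this
  · intro r c
    rw [Tr_rc, Tr_rc]
  · intro r e
    rw [Tr_re, Tr_re, h2]
  · intro c e
    rw [Tr_ce, Tr_ce, h1]
  · rintro r ⟨⟨r', c, e⟩, h, rfl⟩
    exact Tr_row hm hX (mem_Tr.1 h).1
  · rintro r ⟨⟨r', c, e⟩, h, rfl⟩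
    exact Tr_col hm hX (mem_Tr.1 h).2.1
  · rintro r ⟨⟨r', c, e⟩, h, rfl⟩
    exact Tr_ent hm hX hf (mem_Tr.1 h).2.2.1

theorem Hex.image1 {n : ℕ} {f : ℤ → ℤ} (hf : Hex n f) :
    (Finset.Icc (-(n : ℤ)) n).image f = Finset.Icc (-(n : ℤ)) n := by
  apply Finset.eq_of_subset_of_card_le
  · intro y hy
    obtain ⟨x, hx, rfl⟩ := Finset.mem_image.1 hy
    rw [Finset.mem_Icc] at hx ⊢
    exact hf.b1 x hx.1 hx.2
  · rw [Finset.card_image_of_injOn]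
    intro x hx y hy h
    rw [Finset.mem_coe, Finset.mem_Icc] at hx hy
    exact hf.i1 x y hx.1 hx.2 hy.1 hy.2 h

theorem Hex.image2 {n : ℕ} {f : ℤ → ℤ} (hf : Hex n f) :
    (Finset.Icc (-(n : ℤ)) n).image (fun x => x + f x) = Finset.Icc (-(n : ℤ)) n := by
  apply Finset.eq_of_subset_of_card_le
  · intro y hy
    obtain ⟨x, hx, rfl⟩ := Finset.mem_image.1 hy
    rw [Finset.mem_Icc] at hx ⊢
    exact hf.b2 x hx.1 hx.2
  · rw [Finset.card_image_of_injOn]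
    intro x hx y hy h
    rw [Finset.mem_coe, Finset.mem_Icc] at hx hy
    exact hf.i2 x y hx.1 hx.2 hy.1 hy.2 h

theorem image_erase_injOn {S : Finset ℤ} {f : ℤ → ℤ} (hf : Set.InjOn f S) {a : ℤ} (ha : a ∈ S) :
    (S.erase a).image f = (S.image f).erase (f a) := by
  ext y
  simp only [Finset.mem_image, Finset.mem_erase]
  constructor
  · rintro ⟨x, ⟨h1, h2⟩, rfl⟩
    exact ⟨fun h => h1 (hf h2 ha h), x, h2, rfl⟩
  · rintro ⟨h, x, h2, rfl⟩
    exact ⟨x, ⟨fun h' => h (by rw [h']), h2⟩, rfl⟩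

/-- Two disjoint placements. -/
theorem disj_pair (n : ℕ) (hn : 1 ≤ n) : ∃ f g : ℤ → ℤ, Hex n f ∧ Hex n g ∧
    ∀ x : ℤ, -n ≤ x → x ≤ n → f x ≠ g x := by
  refine ⟨fun x => if 0 ≤ x then n - 2 * x else -n - 1 - 2 * x,
    fun x => if x ≤ 0 then -n - 2 * x else n + 1 - 2 * x, ⟨?_, ?_, ?_, ?_⟩, ⟨?_, ?_, ?_, ?_⟩, ?_⟩
  all_goals
    intros
    grind

/-- Two placements which agree exactly once. -/
def OnePair (n : ℕ) : Prop := ∃ f g : ℤ → ℤ, Hex n f ∧ Hex n g ∧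
    ∃ a : ℤ, -n ≤ a ∧ a ≤ n ∧ f a = g a ∧ ∀ x : ℤ, -n ≤ x → x ≤ n → f x = g x → x = a

theorem one_lin (n : ℕ) (hn : 2 ≤ n) (h3 : n % 3 ≠ 1) : OnePair n := by
  refine ⟨fun x => if 0 ≤ x then n - 2 * x else -n - 1 - 2 * x,
    fun x => if 0 ≤ x then x - n else x + n + 1, ⟨?_, ?_, ?_, ?_⟩, ⟨?_, ?_, ?_, ?_⟩,
      if n % 3 = 0 then 2 * (n / 3 : ℕ) else -2 * ((n + 1) / 3 : ℕ), ?_, ?_, ?_, ?_⟩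
  all_goals
    intros
    grind

theorem one_four : OnePair 4 := by
  refine ⟨fun x => if x = -4 then 0 else if x = -3 then 1 else if x = -2 then -1 else
      if x = -1 then 3 else if x = 0 then 4 else if x = 1 then 2 else if x = 2 then -3 else
      if x = 3 then -2 else -4,
    fun x => if x = -4 then 0 else if x = -3 then 2 else if x = -2 then 3 else
      if x = -1 then 4 else if x = 0 then -3 else if x = 1 then -1 else if x = 2 then -4 else
      if x = 3 then 1 else -2, ⟨?_, ?_, ?_, ?_⟩, ⟨?_, ?_, ?_, ?_⟩, -4, ?_, ?_, ?_, ?_⟩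
  all_goals
    push_cast
    try intro x
    try intro y
    all_goals try intros
    try interval_cases x
    all_goals try interval_cases y
    all_goals simp_all

/-- Substituting placements into the hexagon of side two. -/
theorem hex_triple (n : ℕ) {a b : ℤ → ℤ} (ha : Hex n a) (hb : Hex n b) :
    Hex (3 * n + 1) (fun x => if x < -n then a (x + (2 * n + 1))
      else if x ≤ n then (2 * n + 1) + b x else -(2 * n + 1) + a (x - (2 * n + 1))) := by
  have key : ∀ x : ℤ, -(3 * n + 1) ≤ x → x ≤ 3 * n + 1 →
      ∃ q s t : ℤ, x = q * (2 * n + 1) + s ∧ -n ≤ s ∧ s ≤ n ∧ -n ≤ t ∧ t ≤ n ∧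
        -n ≤ s + t ∧ s + t ≤ n ∧
        ((q = -1 ∧ t = a s ∧ (if x < -n then a (x + (2 * n + 1))
      else if x ≤ n then (2 * n + 1) + b x else -(2 * n + 1) + a (x - (2 * n + 1))) = t) ∨
        (q = 0 ∧ t = b s ∧ (if x < -n then a (x + (2 * n + 1))
      else if x ≤ n then (2 * n + 1) + b x else -(2 * n + 1) + a (x - (2 * n + 1))) =
        (2 * n + 1) + t) ∨
        (q = 1 ∧ t = a s ∧ (if x < -n then a (x + (2 * n + 1))
      else if x ≤ n then (2 * n + 1) + b x else -(2 * n + 1) + a (x - (2 * n + 1))) =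
        -(2 * n + 1) + t)) := by
    intro x h1 h2
    by_cases c1 : x < -n
    · have k1 := ha.b1 (x + (2 * n + 1)) (by omega) (by omega)
      have k2 := ha.b2 (x + (2 * n + 1)) (by omega) (by omega)
      exact ⟨-1, x + (2 * n + 1), a (x + (2 * n + 1)), by ring, by omega, by omega, k1.1, k1.2,
        k2.1, k2.2, Or.inl ⟨rfl, rfl, by rw [if_pos c1]⟩⟩
    · by_cases c2 : x ≤ n
      · have k1 := hb.b1 x (by omega) (by omega)
        have k2 := hb.b2 x (by omega) (by omega)
        exact ⟨0, x, b x, by ring, by omega, by omega, k1.1, k1.2,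
          k2.1, k2.2, Or.inr (Or.inl ⟨rfl, rfl, by rw [if_neg c1, if_pos c2]⟩)⟩
      · have k1 := ha.b1 (x - (2 * n + 1)) (by omega) (by omega)
        have k2 := ha.b2 (x - (2 * n + 1)) (by omega) (by omega)
        exact ⟨1, x - (2 * n + 1), a (x - (2 * n + 1)), by ring, by omega, by omega, k1.1, k1.2,
          k2.1, k2.2, Or.inr (Or.inr ⟨rfl, rfl, by rw [if_neg c1, if_neg c2]⟩)⟩
  refine ⟨?_, ?_, ?_, ?_⟩
  · intro x h1 h2
    push_cast at h1 h2 ⊢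
    obtain ⟨q, s, t, h⟩ := key x h1 h2
    rcases h with ⟨e, l1, l2, l3, l4, l5, l6, ⟨rfl, -, h⟩ | ⟨rfl, -, h⟩ | ⟨rfl, -, h⟩⟩ <;>
      rw [h] <;> omega
  · intro x h1 h2
    push_cast at h1 h2 ⊢
    obtain ⟨q, s, t, h⟩ := key x h1 h2
    rcases h with ⟨e, l1, l2, l3, l4, l5, l6, ⟨rfl, -, h⟩ | ⟨rfl, -, h⟩ | ⟨rfl, -, h⟩⟩ <;>
      rw [h] <;> omega
  · intro x y h1 h2 h3 h4
    push_cast at h1 h2 h3 h4 ⊢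
    obtain ⟨q, s, t, h⟩ := key x h1 h2
    obtain ⟨q', s', t', h'⟩ := key y h3 h4
    rcases h with ⟨e, l1, l2, l3, l4, l5, l6, ⟨rfl, u, h⟩ | ⟨rfl, u, h⟩ | ⟨rfl, u, h⟩⟩ <;>
      rcases h' with ⟨e', p1, p2, p3, p4, p5, p6, ⟨rfl, v, h'⟩ | ⟨rfl, v, h'⟩ | ⟨rfl, v, h'⟩⟩ <;>
      rw [h, h'] <;> intro hh <;> try (exfalso; omega)
    · have := ha.i1 s s' l1 l2 p1 p2 (by omega); omega
    · have := hb.i1 s s' l1 l2 p1 p2 (by omega); omega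
    · have := ha.i1 s s' l1 l2 p1 p2 (by omega); omega
  · intro x y h1 h2 h3 h4
    push_cast at h1 h2 h3 h4 ⊢
    obtain ⟨q, s, t, h⟩ := key x h1 h2
    obtain ⟨q', s', t', h'⟩ := key y h3 h4
    rcases h with ⟨e, l1, l2, l3, l4, l5, l6, ⟨rfl, u, h⟩ | ⟨rfl, u, h⟩ | ⟨rfl, u, h⟩⟩ <;>
      rcases h' with ⟨e', p1, p2, p3, p4, p5, p6, ⟨rfl, v, h'⟩ | ⟨rfl, v, h'⟩ | ⟨rfl, v, h'⟩⟩ <;>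
      rw [h, h'] <;> intro hh <;> try (exfalso; omega)
    · have := ha.i2 s s' l1 l2 p1 p2 (by omega); omega
    · have := hb.i2 s s' l1 l2 p1 p2 (by omega); omega
    · have := ha.i2 s s' l1 l2 p1 p2 (by omega); omega

theorem one_triple (n : ℕ) (hn : 1 ≤ n) (h : OnePair n) : OnePair (3 * n + 1) := by
  obtain ⟨f, g, hf, hg, a, a1, a2, a3, a4⟩ := h
  obtain ⟨u, v, hu, hv, huv⟩ := disj_pair n hn
  refine ⟨_, _, hex_triple n hu hf, hex_triple n hv hg, a, by omega, by omega, ?_, ?_⟩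
  · simp only [if_neg (show ¬ a < -n by omega), if_pos a2, a3]
  · intro x h1 h2
    push_cast at h1 h2
    split_ifs with c1 c2
    · intro h; exact absurd h (huv _ (by omega) (by omega))
    · intro h; exact a4 x (by omega) c2 (by omega)
    · intro h; exact absurd (by omega) (huv (x - (2 * n + 1)) (by omega) (by omega))

theorem one_all (n : ℕ) (hn : 2 ≤ n) : OnePair n := by
  induction n using Nat.strong_induction_on with
  | _ n ih =>
    by_cases h : n % 3 = 1
    · by_cases h4 : n = 4
      · subst h4; exact one_four
      · obtain ⟨j, rfl⟩ : ∃ j, n = 3 * j + 1 := ⟨n / 3, by omega⟩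
        exact one_triple j (by omega) (ih j (by omega) (by omega))
    · exact one_lin n hn h

/-- The cyclic Latin square, shifted by `s`. -/
def Cy (k : ℕ) (s : ℕ) : Finset (ℕ × ℕ × ℕ) :=
  (Finset.range k ×ˢ Finset.range k).image (fun p => (p.1, p.2, mdN k (p.1 + p.2 + s)))

theorem mem_Cy {k s r c e : ℕ} : (r, c, e) ∈ Cy k s ↔
    r < k ∧ c < k ∧ e < k ∧ (k : ℤ) ∣ (e : ℤ) - (r + c + s) := by
  simp only [Cy, Finset.mem_image, Finset.mem_product, Finset.mem_range, Prod.mk.injEq,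
    Prod.exists]
  constructor
  · rintro ⟨r, c, h, rfl, rfl, rfl⟩
    exact ⟨h.1, h.2, mdN_lt (by omega) _, mdN_dvd (by omega) _⟩
  · rintro ⟨h1, h2, h3, h4⟩
    exact ⟨r, c, ⟨h1, h2⟩, rfl, rfl, (mdN_uniq h3 h4).symm⟩

theorem Cy_pls (k s : ℕ) : IsPartialLatinSquare (Cy k s) := by
  refine ⟨?_, ?_, ?_⟩ <;>
  · rintro ⟨r, c, e⟩ h1 ⟨r', c', e'⟩ h2 hr hc
    simp only at hr hc
    subst hr hc
    obtain ⟨a1, a2, a3, d1⟩ := mem_Cy.1 h1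
    obtain ⟨b1, b2, b3, d2⟩ := mem_Cy.1 h2
    have d3 := dvd_sub d1 d2
    have d4 := dvd_sub d2 d1
    simp only [Prod.mk.injEq, true_and, and_true]
    zify
    refine dvd_small (m := k) ?_ (by omega) (by omega)
    ring_nf at d3 d4 ⊢
    first
      | exact d3
      | exact d4

theorem Cy_rc {k s r c : ℕ} : (∃ e, (r, c, e) ∈ Cy k s) ↔ r < k ∧ c < k := by
  constructor
  · rintro ⟨e, h⟩
    have := mem_Cy.1 h
    exact ⟨this.1, this.2.1⟩
  · rintro ⟨h1, h2⟩
    exact ⟨_, mem_Cy.2 ⟨h1, h2, mdN_lt (by omega) _, mdN_dvd (by omega) _⟩⟩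

theorem Cy_re {k s r c : ℕ} : (∃ e, (r, e, c) ∈ Cy k s) ↔ r < k ∧ c < k := by
  constructor
  · rintro ⟨e, h⟩
    have := mem_Cy.1 h
    exact ⟨this.1, this.2.2.1⟩
  · rintro ⟨h1, h2⟩
    refine ⟨mdN k (c - r - s), mem_Cy.2 ⟨h1, mdN_lt (by omega) _, h2, ?_⟩⟩
    have := dvd_neg.2 (mdN_dvd (m := k) (by omega) ((c : ℤ) - r - s))
    ring_nf at this ⊢
    exact this

theorem Cy_ce {k s r c : ℕ} : (∃ e, (e, r, c) ∈ Cy k s) ↔ r < k ∧ c < k := by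
  constructor
  · rintro ⟨e, h⟩
    have := mem_Cy.1 h
    exact ⟨this.2.1, this.2.2.1⟩
  · rintro ⟨h1, h2⟩
    refine ⟨mdN k (c - r - s), mem_Cy.2 ⟨mdN_lt (by omega) _, h1, h2, ?_⟩⟩
    have := dvd_neg.2 (mdN_dvd (m := k) (by omega) ((c : ℤ) - r - s))
    ring_nf at this ⊢
    exact this

theorem card_of_bij {k : ℕ} (S : Finset (ℕ × ℕ × ℕ)) (p : ℕ × ℕ × ℕ → ℕ)
    (h1 : ∀ x ∈ S, p x < k) (h2 : ∀ x ∈ S, ∀ y ∈ S, p x = p y → x = y)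
    (h3 : ∀ i < k, ∃ x ∈ S, p x = i) : S.card = k := by
  have : S.image p = Finset.range k := by
    ext i
    simp only [Finset.mem_image, Finset.mem_range]
    constructor
    · rintro ⟨x, hx, rfl⟩; exact h1 x hx
    · exact h3 i
  rw [← Finset.card_range k, ← this, Finset.card_image_of_injOn]
  intro x hx y hy h
  exact h2 x hx y hy h

theorem square_case (k : ℕ) (hk : 2 ≤ k) : ∃ T T' : Finset (ℕ × ℕ × ℕ),
        IsHomogeneousLatinBitrade k T T' ∧ T.card = k * k := by
  refine ⟨Cy k 0, Cy k 1, ⟨⟨Cy_pls k 0, Cy_pls k 1, ?_, ?_, ?_, ?_⟩, ?_, ?_, ?_⟩, ?_⟩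
  · rw [Finset.disjoint_left]
    rintro ⟨r, c, e⟩ h1 h2
    obtain ⟨a1, a2, a3, d1⟩ := mem_Cy.1 h1
    obtain ⟨b1, b2, b3, d2⟩ := mem_Cy.1 h2
    have := dvd_sub d1 d2
    have h : (k : ℤ) ∣ 1 - 0 := by
      push_cast at this
      ring_nf at this ⊢
      exact this
    have := dvd_small h (by omega) (by omega)
    omega
  · intro r c; rw [Cy_rc, Cy_rc]
  · intro r c; rw [Cy_re, Cy_re]
  · intro r c; rw [Cy_ce, Cy_ce]
  · rintro r ⟨⟨r, c, e⟩, h, rfl⟩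
    have hr := (mem_Cy.1 h).1
    refine card_of_bij _ (fun x => x.2.1) ?_ ?_ ?_
    · rintro ⟨a, b, d⟩ hx
      exact (mem_Cy.1 (Finset.mem_filter.1 hx).1).2.1
    · intro x hx y hy hxy
      rw [Finset.mem_filter] at hx hy
      exact (Cy_pls k 0).1 x hx.1 y hy.1 (hx.2.trans hy.2.symm) hxy
    · intro i hi
      obtain ⟨e', he⟩ := (Cy_rc (k := k) (s := 0) (r := r) (c := i)).2 ⟨hr, hi⟩
      exact ⟨_, Finset.mem_filter.2 ⟨he, rfl⟩, rfl⟩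
  · rintro r ⟨⟨r, c, e⟩, h, rfl⟩
    have hr := (mem_Cy.1 h).2.1
    refine card_of_bij _ (fun x => x.1) ?_ ?_ ?_
    · rintro ⟨a, b, d⟩ hx
      exact (mem_Cy.1 (Finset.mem_filter.1 hx).1).1
    · intro x hx y hy hxy
      rw [Finset.mem_filter] at hx hy
      exact (Cy_pls k 0).1 x hx.1 y hy.1 hxy (hx.2.trans hy.2.symm)
    · intro i hi
      obtain ⟨e', he⟩ := (Cy_rc (k := k) (s := 0) (r := i) (c := c)).2 ⟨hi, hr⟩
      exact ⟨_, Finset.mem_filter.2 ⟨he, rfl⟩, rfl⟩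
  · rintro r ⟨⟨r, c, e⟩, h, rfl⟩
    have hr := (mem_Cy.1 h).2.2.1
    refine card_of_bij _ (fun x => x.1) ?_ ?_ ?_
    · rintro ⟨a, b, d⟩ hx
      exact (mem_Cy.1 (Finset.mem_filter.1 hx).1).1
    · intro x hx y hy hxy
      rw [Finset.mem_filter] at hx hy
      exact (Cy_pls k 0).2.1 x hx.1 y hy.1 hxy (hx.2.trans hy.2.symm)
    · intro i hi
      obtain ⟨e', he⟩ := (Cy_re (k := k) (s := 0) (r := i) (c := e)).2 ⟨hi, hr⟩
      exact ⟨_, Finset.mem_filter.2 ⟨he, rfl⟩, rfl⟩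
  · unfold Cy
    rw [Finset.card_image_of_injOn, Finset.card_product, Finset.card_range]
    rintro ⟨a, b⟩ - ⟨c, d⟩ - h
    simp only [Prod.mk.injEq] at h ⊢
    exact ⟨h.1, h.2.1⟩

theorem stmt_9 (k : ℕ) (hk : 3 ≤ k) (hdvd : 3 ∣ k ∨ 5 ∣ k) :
    ∀ m : ℕ, k ≤ m →
      ∃ T T' : Finset (ℕ × ℕ × ℕ),
        IsHomogeneousLatinBitrade k T T' ∧ T.card = k * m := by
  intro m hkm
  rcases Nat.even_or_odd' k with ⟨n, rfl | rfl⟩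
  · rcases eq_or_lt_of_le hkm with rfl | hlt
    · exact square_case _ (by omega)
    · obtain ⟨f, g, hf, hg, a, a1, a2, a3, a4⟩ := one_all n (by omega)
      have ha : a ∈ Finset.Icc (-(n : ℤ)) n := Finset.mem_Icc.2 ⟨a1, a2⟩
      have inj1 : ∀ {f : ℤ → ℤ}, Hex n f →
          Set.InjOn f (Finset.Icc (-(n : ℤ)) n : Finset ℤ) := by
        intro f hf x hx y hy h
        rw [Finset.mem_coe, Finset.mem_Icc] at hx hy
        exact hf.i1 x y hx.1 hx.2 hy.1 hy.2 h
      have inj2 : ∀ {f : ℤ → ℤ}, Hex n f →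
          Set.InjOn (fun x => x + f x) (Finset.Icc (-(n : ℤ)) n : Finset ℤ) := by
        intro f hf x hx y hy h
        rw [Finset.mem_coe, Finset.mem_Icc] at hx hy
        exact hf.i2 x y hx.1 hx.2 hy.1 hy.2 h
      have hc : ((Finset.Icc (-(n : ℤ)) n).erase a).card = 2 * n := by
        rw [Finset.card_erase_of_mem ha, Int.card_Icc]; omega
      have := circ_s9 (m := m) (n := n) (X := (Finset.Icc (-(n : ℤ)) n).erase a) (by omega)
        (fun x hx => Finset.mem_Icc.1 (Finset.mem_of_mem_erase hx)) hf hg ?_ ?_ ?_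
      · rwa [hc] at this
      · intro x hx h
        rw [Finset.mem_erase, Finset.mem_Icc] at hx
        exact hx.1 (a4 x hx.2.1 hx.2.2 h)
      · rw [image_erase_injOn (inj1 hf) ha, image_erase_injOn (inj1 hg) ha, hf.image1, hg.image1,
          a3]
      · rw [image_erase_injOn (inj2 hf) ha, image_erase_injOn (inj2 hg) ha, hf.image2, hg.image2,
          a3]
  · obtain ⟨f, g, hf, hg, hd⟩ := disj_pair n (by omega)
    have := circ_s9 (m := m) (n := n) (X := Finset.Icc (-(n : ℤ)) n) hkm
      (fun x hx => Finset.mem_Icc.1 hx) hf hg ?_ ?_ ?_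
    · have hc : (Finset.Icc (-(n : ℤ)) n).card = 2 * n + 1 := by rw [Int.card_Icc]; omega
      rwa [hc] at this
    · intro x hx
      rw [Finset.mem_Icc] at hx
      exact hd x hx.1 hx.2
    · rw [hf.image1, hg.image1]
    · rw [hf.image2, hg.image2]
end
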